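/- arXiv:2112.10191 — 3 statements merged into one kernel-verified Lean document; each statement's English description precedes it below -/
import Mathlib

section
/- Let f : [−1,1] → (−1,1) be C^∞ with f(0) = 0 and 0 < f′(x) < 1 for all x. Then there exists a unique C^∞ diffeomorphism h : [−1,1] → h([−1,1]) ⊂ ℝ such that h(f(x)) = f′(0)·h(x) for all x ∈ [−1,1], h(0) = 0, and h′(0) = 1. -/
open Set

/-- `h` is a smooth linearizer of `f` on `[-1,1]`: a smooth diffeomorphism onto its image
with `h(0) = 0`, `h'(0) = 1`, conjugating `f` to multiplication by `f'(0)`. -/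
def IsSmoothLinearizer (f h : ℝ → ℝ) : Prop :=
  ContDiff ℝ (⊤ : ℕ∞) h ∧ InjOn h (Icc (-1) 1) ∧ (∀ x ∈ Icc (-1 : ℝ) 1, deriv h x ≠ 0) ∧
  h 0 = 0 ∧ deriv h 0 = 1 ∧ ∀ x ∈ Icc (-1 : ℝ) 1, h (f x) = deriv f 0 * h x

open Filter Topology

/-- Every smooth function on the line has a smooth primitive vanishing at `0`. -/
lemma exists_smooth_primitive {F : ℝ → ℝ} (hF : ContDiff ℝ (⊤ : ℕ∞) F) :
    ∃ P : ℝ → ℝ, ContDiff ℝ (⊤ : ℕ∞) P ∧ P 0 = 0 ∧ ∀ x, HasDerivAt P (F x) x := by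
  have key : ∀ x, HasDerivAt (fun u => ∫ t in (0 : ℝ)..u, F t) (F x) x := fun x =>
    intervalIntegral.integral_hasDerivAt_right (hF.continuous.intervalIntegrable _ _)
      (hF.continuous.stronglyMeasurableAtFilter _ _) hF.continuous.continuousAt
  refine ⟨_, contDiff_infty_iff_deriv.2 ⟨fun x => (key x).differentiableAt, ?_⟩, by simp, key⟩
  rwa [show deriv (fun u => ∫ t in (0 : ℝ)..u, F t) = F from funext fun x => (key x).deriv]

/-- The terms of the Neumann series solving `v = φ + w * v ∘ g`. -/
def neumannTerm (φ w g : ℝ → ℝ) : ℕ → ℝ → ℝ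
  | 0 => φ
  | n + 1 => fun x => w x * neumannTerm φ w g n (g x)

/-- The derivatives of the functions `neumannTerm φ w g n`. -/
noncomputable def neumannTermDeriv (φ w g : ℝ → ℝ) : ℕ → ℝ → ℝ
  | 0 => deriv φ
  | n + 1 => fun x => deriv w x * neumannTerm φ w g n (g x) +
      w x * (neumannTermDeriv φ w g n (g x) * deriv g x)

section CohomologicalEquation

variable {φ w g : ℝ → ℝ}

lemma hasDerivAt_neumannTerm (hφ : ContDiff ℝ 1 φ) (hw : ContDiff ℝ 1 w) (hg : ContDiff ℝ 1 g)
    (n : ℕ) (x : ℝ) : HasDerivAt (neumannTerm φ w g n) (neumannTermDeriv φ w g n x) x := by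
  induction n generalizing x with
  | zero => exact (hφ.differentiable one_ne_zero x).hasDerivAt
  | succ n ih =>
    exact (hw.differentiable one_ne_zero x).hasDerivAt.mul
      ((ih (g x)).comp x (hg.differentiable one_ne_zero x).hasDerivAt)

lemma continuous_neumannTermDeriv (hφ : ContDiff ℝ 1 φ) (hw : ContDiff ℝ 1 w)
    (hg : ContDiff ℝ 1 g) (n : ℕ) : Continuous (neumannTermDeriv φ w g n) := by
  induction n with
  | zero => exact hφ.continuous_deriv le_rfl
  | succ n ih =>
    have h : Continuous (neumannTerm φ w g n) := continuous_iff_continuousAt.2 fun x =>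
      (hasDerivAt_neumannTerm hφ hw hg n x).continuousAt
    exact ((hw.continuous_deriv le_rfl).mul (h.comp hg.continuous)).add
      (hw.continuous.mul ((ih.comp hg.continuous).mul (hg.continuous_deriv le_rfl)))

lemma exists_summable_bound_neumannTerm (hφ : ContDiff ℝ 1 φ) (hw : ContDiff ℝ 1 w)
    (hw1 : ∀ x, |w x| < 1) (hg1 : ∀ x, |deriv g x| ≤ 1)
    (hgx : ∀ x, |g x| ≤ |x|) (R : ℝ) :
    ∃ b : ℕ → ℝ, Summable b ∧ ∀ n x, |x| ≤ R →
      |neumannTerm φ w g n x| ≤ b n ∧ |neumannTermDeriv φ w g n x| ≤ b n := by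
  have bdd : ∀ F : ℝ → ℝ, Continuous F → ∃ C, 0 ≤ C ∧ ∀ x, |x| ≤ R → |F x| ≤ C := by
    intro F hF
    obtain ⟨C, hC⟩ := (isCompact_Icc (a := -R) (b := R)).exists_bound_of_continuousOn
      hF.continuousOn
    exact ⟨max C 0, le_max_right _ _, fun x hx => (hC x (abs_le.1 hx)).trans (le_max_left _ _)⟩
  obtain ⟨μ, hμ0, hμ1, hμ⟩ : ∃ μ, 0 ≤ μ ∧ μ < 1 ∧ ∀ x, |x| ≤ R → |w x| ≤ μ := by
    rcases (Icc (-R) R).eq_empty_or_nonempty with he | hne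
    · refine ⟨0, le_rfl, one_pos, fun x hx => ?_⟩
      have : x ∈ Icc (-R) R := abs_le.1 hx
      simp [he] at this
    · obtain ⟨y, -, hy⟩ := isCompact_Icc.exists_isMaxOn hne hw.continuous.abs.continuousOn
      exact ⟨|w y|, abs_nonneg _, hw1 y, fun x hx => hy (abs_le.1 hx)⟩
  obtain ⟨K, hK0, hK⟩ := bdd φ hφ.continuous
  obtain ⟨K', hK'0, hK'⟩ := bdd _ (hφ.continuous_deriv le_rfl)
  obtain ⟨B, hB0, hB⟩ := bdd _ (hw.continuous_deriv le_rfl)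
  obtain ⟨ν, hμν, hν1⟩ := exists_between hμ1
  have hν0 : 0 ≤ ν := hμ0.trans hμν.le
  have hd : 0 < ν - μ := sub_pos.2 hμν
  set L := K' + B * K / (ν - μ) with hL
  have hL0 : 0 ≤ L := by positivity
  have hBK : B * K + μ * L ≤ L * ν := by
    have : L * (ν - μ) = K' * (ν - μ) + B * K := by rw [hL]; field_simp
    nlinarith [mul_nonneg hK'0 hd.le]
  have main : ∀ n x, |x| ≤ R →
      |neumannTerm φ w g n x| ≤ K * ν ^ n ∧ |neumannTermDeriv φ w g n x| ≤ L * ν ^ n := by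
    intro n
    induction n with
    | zero =>
      intro x hx
      have : 0 ≤ B * K / (ν - μ) := by positivity
      exact ⟨by simpa [neumannTerm] using hK x hx, by
        simpa [neumannTermDeriv] using (hK' x hx).trans (by rw [hL]; linarith)⟩
    | succ n ih =>
      intro x hx
      obtain ⟨h1, h2⟩ := ih (g x) ((hgx x).trans hx)
      have hp : 0 ≤ ν ^ n := pow_nonneg hν0 n
      constructor
      · calc |w x * neumannTerm φ w g n (g x)|
            = |w x| * |neumannTerm φ w g n (g x)| := abs_mul _ _
          _ ≤ ν * (K * ν ^ n) := by
            gcongr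
            exact (hμ x hx).trans hμν.le
          _ = K * ν ^ (n + 1) := by ring
      · calc |deriv w x * neumannTerm φ w g n (g x) +
              w x * (neumannTermDeriv φ w g n (g x) * deriv g x)|
            ≤ |deriv w x| * |neumannTerm φ w g n (g x)| +
              |w x| * (|neumannTermDeriv φ w g n (g x)| * |deriv g x|) := by
              rw [← abs_mul, ← abs_mul, ← abs_mul]; exact abs_add_le _ _
          _ ≤ B * (K * ν ^ n) + μ * (L * ν ^ n * 1) := by
            gcongr
            exacts [hB x hx, hμ x hx, hg1 x]
          _ = (B * K + μ * L) * ν ^ n := by ring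
          _ ≤ L * ν * ν ^ n := by gcongr
          _ = L * ν ^ (n + 1) := by ring
  refine ⟨fun n => (K + L) * ν ^ n, (summable_geometric_of_lt_one hν0 hν1).mul_left _,
    fun n x hx => ⟨(main n x hx).1.trans ?_, (main n x hx).2.trans ?_⟩⟩
  · exact mul_le_mul_of_nonneg_right (le_add_of_nonneg_right hL0) (pow_nonneg hν0 n)
  · exact mul_le_mul_of_nonneg_right (le_add_of_nonneg_left hK0) (pow_nonneg hν0 n)

/-- If the data are `C^1`, then `v = φ + w * v ∘ g` has a `C^1` solution. -/
lemma exists_contDiff_one_solution (hφ : ContDiff ℝ 1 φ) (hw : ContDiff ℝ 1 w)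
    (hg : ContDiff ℝ 1 g) (hw1 : ∀ x, |w x| < 1) (hg1 : ∀ x, |deriv g x| ≤ 1)
    (hgx : ∀ x, |g x| ≤ |x|) :
    ∃ v : ℝ → ℝ, ContDiff ℝ 1 v ∧ ∀ x, v x = φ x + w x * v (g x) := by
  have hsum : ∀ x, Summable fun n => neumannTerm φ w g n x := by
    intro x
    obtain ⟨b, hb, hbd⟩ := exists_summable_bound_neumannTerm hφ hw hw1 hg1 hgx |x|
    exact hb.of_norm_bounded fun n => (hbd n x le_rfl).1
  have hder : ∀ x, HasDerivAt (fun z => ∑' n, neumannTerm φ w g n z)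
      (∑' n, neumannTermDeriv φ w g n x) x := by
    intro x
    obtain ⟨b, hb, hbd⟩ := exists_summable_bound_neumannTerm hφ hw hw1 hg1 hgx (|x| + 1)
    have hx : x ∈ Metric.ball (0 : ℝ) (|x| + 1) := by simp
    refine hasDerivAt_tsum_of_isPreconnected hb Metric.isOpen_ball
      (convex_ball _ _).isPreconnected (fun n y _ => hasDerivAt_neumannTerm hφ hw hg n y)
      (fun n y hy => (hbd n y ?_).2) hx (hsum x) hx
    simpa using (Metric.mem_ball.1 hy).le
  refine ⟨fun z => ∑' n, neumannTerm φ w g n z, contDiff_one_iff_deriv.2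
    ⟨fun x => (hder x).differentiableAt, ?_⟩, fun x => ?_⟩
  · rw [show deriv (fun z => ∑' n, neumannTerm φ w g n z) =
      fun x => ∑' n, neumannTermDeriv φ w g n x from funext fun x => (hder x).deriv]
    refine continuous_iff_continuousAt.2 fun x => ?_
    obtain ⟨b, hb, hbd⟩ := exists_summable_bound_neumannTerm hφ hw hw1 hg1 hgx (|x| + 1)
    have hx : x ∈ Metric.ball (0 : ℝ) (|x| + 1) := by simp
    refine (continuousOn_tsum (fun n => (continuous_neumannTermDeriv hφ hw hg n).continuousOn) hb
      fun n y hy => (hbd n y ?_).2).continuousAt (Metric.isOpen_ball.mem_nhds hx)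
    simpa using (Metric.mem_ball.1 hy).le
  · have := (hsum x).tsum_eq_zero_add
    simpa [neumannTerm, tsum_mul_left] using this

/-- The equation `v = φ + w * v ∘ g` has at most one continuous solution. -/
lemma eq_of_continuous_solution (hw1 : ∀ x, |w x| < 1) (hgx : ∀ x, |g x| ≤ |x|) {v₁ v₂ : ℝ → ℝ}
    (hc₁ : Continuous v₁) (hc₂ : Continuous v₂) (h₁ : ∀ x, v₁ x = φ x + w x * v₁ (g x))
    (h₂ : ∀ x, v₂ x = φ x + w x * v₂ (g x)) : v₁ = v₂ := by
  funext x
  have hx : x ∈ Icc (-|x|) |x| := abs_le.1 le_rfl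
  obtain ⟨y, hy, hmax⟩ := isCompact_Icc.exists_isMaxOn ⟨x, hx⟩ (hc₁.sub hc₂).abs.continuousOn
  have hgy : |v₁ (g y) - v₂ (g y)| ≤ |v₁ y - v₂ y| :=
    hmax (abs_le.1 ((hgx y).trans (abs_le.2 hy)))
  have hxy : |v₁ x - v₂ x| ≤ |v₁ y - v₂ y| := hmax hx
  have he : |v₁ y - v₂ y| = |w y| * |v₁ (g y) - v₂ (g y)| := by
    rw [← abs_mul, h₁ y, h₂ y]; congr 1; ring
  have h0 : |v₁ y - v₂ y| ≤ 0 := by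
    by_contra! hpos
    nlinarith [hw1 y, mul_le_mul_of_nonneg_left hgy (abs_nonneg (w y))]
  exact sub_eq_zero.1 (abs_eq_zero.1 (le_antisymm (hxy.trans h0) (abs_nonneg _)))

/-- Continuous solutions of `v = φ + w * v ∘ g` are as regular as `φ`. -/
lemma contDiff_solution (hg : ContDiff ℝ (⊤ : ℕ∞) g) (hg1 : ∀ x, |deriv g x| ≤ 1)
    (hgx : ∀ x, |g x| ≤ |x|) (k : ℕ) {φ w v : ℝ → ℝ} (hφ : ContDiff ℝ k φ)
    (hw : ContDiff ℝ (⊤ : ℕ∞) w) (hw1 : ∀ x, |w x| < 1) (hv : Continuous v)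
    (h : ∀ x, v x = φ x + w x * v (g x)) : ContDiff ℝ k v := by
  induction k generalizing φ w v with
  | zero => exact_mod_cast contDiff_zero.2 hv
  | succ k ih =>
    have hle : ∀ m : ℕ, ((m : ℕ∞) : WithTop ℕ∞) ≤ ((⊤ : ℕ∞) : WithTop ℕ∞) :=
      fun m => WithTop.coe_le_coe.2 le_top
    have hφ1 : ContDiff ℝ 1 φ := hφ.of_le (by push_cast; exact le_add_self)
    have hw' : ContDiff ℝ 1 w := hw.of_le (hle 1)
    have hg' : ContDiff ℝ 1 g := hg.of_le (hle 1)
    obtain ⟨v', hv', hv's⟩ := exists_contDiff_one_solution hφ1 hw' hg' hw1 hg1 hgx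
    obtain rfl : v = v' := eq_of_continuous_solution hw1 hgx hv hv'.continuous h hv's
    have hdv : Differentiable ℝ v := hv'.differentiable one_ne_zero
    have hdg : Differentiable ℝ g := hg'.differentiable one_ne_zero
    have hvk : ContDiff ℝ k v :=
      ih (hφ.of_le (by push_cast; exact le_self_add)) hw hw1 hv h
    have hφk : ContDiff ℝ k (deriv φ) := by
      push_cast at hφ
      exact (contDiff_succ_iff_deriv.1 hφ).2.2
    have hder : ∀ x, deriv v x =
        (deriv φ x + deriv w x * v (g x)) + (w x * deriv g x) * deriv v (g x) := by
      intro x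
      have h1 : HasDerivAt (fun x => φ x + w x * v (g x))
          (deriv φ x + (deriv w x * v (g x) + w x * (deriv v (g x) * deriv g x))) x :=
        (hφ1.differentiable one_ne_zero x).hasDerivAt.add
          ((hw'.differentiable one_ne_zero x).hasDerivAt.mul
            ((hdv (g x)).hasDerivAt.comp x (hdg x).hasDerivAt))
      rw [← show v = fun x => φ x + w x * v (g x) from funext h] at h1
      rw [h1.deriv]; ring
    have hdw : ContDiff ℝ (⊤ : ℕ∞) (deriv w) := (contDiff_infty_iff_deriv.1 hw).2
    have hdgs : ContDiff ℝ (⊤ : ℕ∞) (deriv g) := (contDiff_infty_iff_deriv.1 hg).2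
    have hdvk : ContDiff ℝ k (deriv v) := by
      refine ih (hφk.add ((hdw.of_le (hle k)).mul (hvk.comp (hg.of_le (hle k)))))
        (hw.mul hdgs) (fun x => ?_) (hv'.continuous_deriv le_rfl) hder
      rw [abs_mul]
      exact (mul_le_of_le_one_right (abs_nonneg _) (hg1 x)).trans_lt (hw1 x)
    push_cast
    exact contDiff_succ_iff_deriv.2 ⟨hdv, by simp, hdvk⟩

/-- The equation `v = φ + w * v ∘ g` with smooth data has a smooth solution. -/
lemma exists_smooth_solution (hφ : ContDiff ℝ (⊤ : ℕ∞) φ) (hw : ContDiff ℝ (⊤ : ℕ∞) w)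
    (hg : ContDiff ℝ (⊤ : ℕ∞) g) (hw1 : ∀ x, |w x| < 1) (hg1 : ∀ x, |deriv g x| ≤ 1)
    (hgx : ∀ x, |g x| ≤ |x|) :
    ∃ v : ℝ → ℝ, ContDiff ℝ (⊤ : ℕ∞) v ∧ ∀ x, v x = φ x + w x * v (g x) := by
  have hle : ∀ m : ℕ, ((m : ℕ∞) : WithTop ℕ∞) ≤ ((⊤ : ℕ∞) : WithTop ℕ∞) :=
    fun m => WithTop.coe_le_coe.2 le_top
  obtain ⟨v, hv, h⟩ := exists_contDiff_one_solution (hφ.of_le (hle 1)) (hw.of_le (hle 1))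
    (hg.of_le (hle 1)) hw1 hg1 hgx
  exact ⟨v, contDiff_infty.2 fun k =>
    contDiff_solution hg hg1 hgx k (hφ.of_le (hle k)) hw hw1 hv.continuous h, h⟩

end CohomologicalEquation

/-- Smooth linearization of a smooth map of the line with derivative in `(0, 1)`. -/
lemma exists_global_linearizer {g : ℝ → ℝ} (hg : ContDiff ℝ (⊤ : ℕ∞) g) (hg0 : g 0 = 0)
    (hdg : ∀ x, deriv g x ∈ Ioo (0 : ℝ) 1) :
    ∃ h : ℝ → ℝ, ContDiff ℝ (⊤ : ℕ∞) h ∧ (∀ x, 0 < deriv h x) ∧ h 0 = 0 ∧ deriv h 0 = 1 ∧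
      ∀ x, h (g x) = deriv g 0 * h x := by
  have hdgs : ContDiff ℝ (⊤ : ℕ∞) (deriv g) := (contDiff_infty_iff_deriv.1 hg).2
  have hgd : Differentiable ℝ g := (contDiff_infty_iff_deriv.1 hg).1
  have habs : ∀ x, |deriv g x| < 1 := fun x => by rw [abs_of_pos (hdg x).1]; exact (hdg x).2
  have hgx : ∀ x, |g x| ≤ |x| := by
    intro x
    simpa [hg0] using Convex.norm_image_sub_le_of_norm_deriv_le (f := g) (C := 1)
      (fun y _ => hgd y) (fun y _ => (habs y).le) convex_univ (mem_univ 0) (mem_univ x)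
  set lam := deriv g 0 with hlam
  have hlam0 : 0 < lam := (hdg 0).1
  let φ : ℝ → ℝ := fun x => Real.log (deriv g x / lam)
  have hφ : ContDiff ℝ (⊤ : ℕ∞) φ :=
    (hdgs.div_const lam).log fun x => (div_pos (hdg x).1 hlam0).ne'
  have hφd : Differentiable ℝ φ := (contDiff_infty_iff_deriv.1 hφ).1
  have hφ0 : φ 0 = 0 := by simp [φ, ← hlam, div_self hlam0.ne']
  obtain ⟨v, hv, hveq⟩ := exists_smooth_solution (contDiff_infty_iff_deriv.1 hφ).2 hdgs hg habs
    (fun x => (habs x).le) hgx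
  obtain ⟨u, hu, hu0, hud⟩ := exists_smooth_primitive hv
  have hueq : ∀ x, u x = φ x + u (g x) := by
    have hd : ∀ x, HasDerivAt (fun x => u x - (φ x + u (g x))) 0 x := by
      intro x
      have := (hud x).sub ((hφd x).hasDerivAt.add ((hud (g x)).comp x (hgd x).hasDerivAt))
      rwa [hveq x, mul_comm (v (g x)), sub_self] at this
    intro x
    have := is_const_of_deriv_eq_zero (fun x => (hd x).differentiableAt)
      (fun x => (hd x).deriv) x 0
    simp only [hu0, hφ0, hg0] at this
    linarith
  obtain ⟨h, hh, hh0, hhd⟩ := exists_smooth_primitive hu.exp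
  refine ⟨h, hh, fun x => (hhd x).deriv ▸ Real.exp_pos _, hh0, by simp [(hhd 0).deriv, hu0], ?_⟩
  have hd : ∀ x, HasDerivAt (fun x => h (g x) - lam * h x) 0 x := by
    intro x
    have := ((hhd (g x)).comp x (hgd x).hasDerivAt).sub ((hhd x).const_mul lam)
    have he : Real.exp (u (g x)) * deriv g x - lam * Real.exp (u x) = 0 := by
      rw [hueq x, Real.exp_add, Real.exp_log (div_pos (hdg x).1 hlam0)]
      field_simp
      ring
    rwa [he] at this
  intro x
  have := is_const_of_deriv_eq_zero (fun x => (hd x).differentiableAt) (fun x => (hd x).deriv) x 0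
  simp only [hh0, hg0] at this
  linarith

/-- A smooth function whose derivative lies in `(0, 1)` on `[-1, 1]` agrees there with a smooth
function whose derivative lies in `(0, 1)` everywhere. -/
lemma exists_extension_deriv_mem_Ioo {f : ℝ → ℝ} (hf : ContDiff ℝ (⊤ : ℕ∞) f) (hf0 : f 0 = 0)
    (hdf : ∀ x ∈ Icc (-1 : ℝ) 1, deriv f x ∈ Ioo (0 : ℝ) 1) :
    ∃ g : ℝ → ℝ, ContDiff ℝ (⊤ : ℕ∞) g ∧ (∀ x, deriv g x ∈ Ioo (0 : ℝ) 1) ∧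
      EqOn g f (Icc (-1) 1) ∧ EqOn (deriv g) (deriv f) (Icc (-1) 1) := by
  obtain ⟨hfd, hdfs⟩ := contDiff_infty_iff_deriv.1 hf
  have hopen : IsOpen (deriv f ⁻¹' Ioo 0 1) := isOpen_Ioo.preimage hdfs.continuous
  obtain ⟨χ, hχ1, hχ0, hχ⟩ := exists_contMDiffMap_one_nhds_of_subset_interior
    (n := (⊤ : ℕ∞)) (modelWithCornersSelf ℝ ℝ) (isClosed_Icc (a := (-1 : ℝ)) (b := 1))
    (subset_interior_iff_isOpen.2 hopen |>.trans' hdf)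
  have hχs : ContDiff ℝ (⊤ : ℕ∞) χ := χ.contMDiff.contDiff
  obtain ⟨g, hg, hg0, hgd⟩ := exists_smooth_primitive
    ((hχs.mul hdfs).add ((contDiff_const.sub hχs).mul (contDiff_const (c := (1 / 2 : ℝ)))) :
      ContDiff ℝ (⊤ : ℕ∞) fun x => χ x * deriv f x + (1 - χ x) * (1 / 2))
  have hder : EqOn (deriv g) (deriv f) (Icc (-1) 1) := by
    intro x hx
    have : χ x = 1 := hχ1.self_of_nhdsSet x hx
    rw [(hgd x).deriv, this]; ring
  refine ⟨g, hg, fun x => ?_, fun x hx => ?_, hder⟩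
  · rw [(hgd x).deriv]
    by_cases hx : x ∈ deriv f ⁻¹' Ioo 0 1
    · have := convex_Ioo (0 : ℝ) 1 hx (show (1 / 2 : ℝ) ∈ Ioo 0 1 by constructor <;> norm_num)
        (hχ x).1 (sub_nonneg.2 (hχ x).2) (by ring)
      simpa only [smul_eq_mul] using this
    · rw [hχ0 x hx]; constructor <;> norm_num
  · have := Convex.norm_image_sub_le_of_norm_deriv_le (f := g - f) (C := 0)
      (fun y _ => (hgd y).differentiableAt.sub (hfd y))
      (fun y hy => by
        rw [((hgd y).differentiableAt.hasDerivAt.sub (hfd y).hasDerivAt).deriv, hder hy]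
        simp)
      (convex_Icc (-1 : ℝ) 1) (show (0 : ℝ) ∈ Icc (-1) 1 by constructor <;> norm_num) hx
    simp only [Pi.sub_apply, hg0, hf0, sub_self, sub_zero, zero_mul, norm_le_zero_iff] at this
    linarith

/-- If `f 0 = 0` and `0 < f' < 1` on `[-1, 1]`, then orbits in `[-1, 1]` converge to `0`. -/
lemma tendsto_iterate_zero {f : ℝ → ℝ} (hf : ContDiff ℝ 1 f)
    (hmap : MapsTo f (Icc (-1) 1) (Icc (-1) 1)) (hf0 : f 0 = 0)
    (hdf : ∀ x ∈ Icc (-1 : ℝ) 1, deriv f x ∈ Ioo (0 : ℝ) 1) {x : ℝ} (hx : x ∈ Icc (-1 : ℝ) 1) :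
    Tendsto (fun n => f^[n] x) atTop (𝓝 0) := by
  have h0 : (0 : ℝ) ∈ Icc (-1 : ℝ) 1 := by constructor <;> norm_num
  obtain ⟨y, hy, hmax⟩ := isCompact_Icc.exists_isMaxOn ⟨0, h0⟩
    (hf.continuous_deriv le_rfl).continuousOn
  have hb : ∀ z ∈ Icc (-1 : ℝ) 1, |f z| ≤ deriv f y * |z| := by
    intro z hz
    simpa [hf0] using Convex.norm_image_sub_le_of_norm_deriv_le (f := f) (C := deriv f y)
      (fun t _ => hf.differentiable one_ne_zero t)
      (fun t ht => by rw [Real.norm_of_nonneg (hdf t ht).1.le]; exact hmax ht)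
      (convex_Icc (-1 : ℝ) 1) h0 hz
  have hit : ∀ n, |f^[n] x| ≤ deriv f y ^ n * |x| := by
    intro n
    induction n with
    | zero => simp
    | succ n ih =>
      rw [Function.iterate_succ_apply']
      calc |f (f^[n] x)| ≤ deriv f y * |f^[n] x| := hb _ (hmap.iterate n hx)
        _ ≤ deriv f y * (deriv f y ^ n * |x|) := by
          have := (hdf y hy).1.le
          gcongr
        _ = deriv f y ^ (n + 1) * |x| := by ring
  refine squeeze_zero_norm hit ?_
  simpa using (tendsto_pow_atTop_nhds_zero_of_lt_one (hdf y hy).1.le (hdf y hy).2).mul_const |x|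

/-- Two functions vanishing at `0` with derivative `1` there have quotient tending to `1`. -/
lemma tendsto_div_of_deriv_eq_one {h₁ h₂ : ℝ → ℝ} (hd₁ : HasDerivAt h₁ 1 0)
    (hd₂ : HasDerivAt h₂ 1 0) (h₁0 : h₁ 0 = 0) (h₂0 : h₂ 0 = 0) :
    Tendsto (fun x => h₁ x / h₂ x) (𝓝[≠] 0) (𝓝 1) := by
  have t₁ := hasDerivAt_iff_tendsto_slope_zero.1 hd₁
  have t₂ := hasDerivAt_iff_tendsto_slope_zero.1 hd₂
  have := t₁.div t₂ one_ne_zero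
  rw [div_one] at this
  refine this.congr' ?_
  filter_upwards [self_mem_nhdsWithin] with x hx
  have hx : x ≠ 0 := hx
  simp only [Pi.div_apply, zero_add, h₁0, h₂0, sub_zero, smul_eq_mul]
  exact mul_div_mul_left _ _ (inv_ne_zero hx)

/-- Let `f : [−1,1] → (−1,1)` be `C^∞` with `f(0) = 0` and `0 < f′ < 1` on
`[−1,1]`. Then there exists a unique `C^∞` diffeomorphism `h` of `[−1,1]` onto its image
with `h(f(x)) = f′(0)·h(x)`, `h(0) = 0`, `h′(0) = 1` (uniqueness as functions on `[−1,1]`). -/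
theorem stmt6 (f : ℝ → ℝ) (hf : ContDiff ℝ (⊤ : ℕ∞) f)
    (hmap : MapsTo f (Icc (-1) 1) (Ioo (-1) 1))
    (hf0 : f 0 = 0)
    (hdf : ∀ x ∈ Icc (-1 : ℝ) 1, deriv f x ∈ Ioo (0 : ℝ) 1) :
    (∃ h : ℝ → ℝ, IsSmoothLinearizer f h) ∧
    ∀ h₁ h₂ : ℝ → ℝ, IsSmoothLinearizer f h₁ → IsSmoothLinearizer f h₂ →
      EqOn h₁ h₂ (Icc (-1) 1) := by
  have h0 : (0 : ℝ) ∈ Icc (-1 : ℝ) 1 := by constructor <;> norm_num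
  constructor
  · obtain ⟨g, hg, hdg, hgf, hdgf⟩ := exists_extension_deriv_mem_Ioo hf hf0 hdf
    obtain ⟨h, hh, hpos, hh0, hd0, heq⟩ := exists_global_linearizer hg ((hgf h0).trans hf0) hdg
    refine ⟨h, hh, (strictMono_of_deriv_pos hpos).injective.injOn, fun x _ => (hpos x).ne', hh0,
      hd0, fun x hx => ?_⟩
    rw [← hgf hx, ← hdgf h0, heq]
  · rintro h₁ h₂ ⟨hs₁, -, -, h₁0, hd₁, he₁⟩ ⟨hs₂, hi₂, -, h₂0, hd₂, he₂⟩ x hx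
    have hmap' : MapsTo f (Icc (-1) 1) (Icc (-1) 1) := hmap.mono_right Ioo_subset_Icc_self
    have hlam : deriv f 0 ≠ 0 := (hdf 0 h0).1.ne'
    have hderiv : ∀ h : ℝ → ℝ, ContDiff ℝ (⊤ : ℕ∞) h → deriv h 0 = 1 → HasDerivAt h 1 0 :=
      fun h hs hd => hd ▸ ((contDiff_infty_iff_deriv.1 hs).1 0).hasDerivAt
    have hit : ∀ h : ℝ → ℝ, (∀ x ∈ Icc (-1 : ℝ) 1, h (f x) = deriv f 0 * h x) →
        ∀ n, h (f^[n] x) = deriv f 0 ^ n * h x := by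
      intro h he n
      induction n with
      | zero => simp
      | succ n ih =>
        rw [Function.iterate_succ_apply', he _ (hmap'.iterate n hx), ih]; ring
    rcases eq_or_ne x 0 with rfl | hx0
    · rw [h₁0, h₂0]
    have hne : h₂ x ≠ 0 := fun hz => hx0 (hi₂ hx h0 (hz.trans h₂0.symm))
    have hnz : ∀ n, f^[n] x ≠ 0 := by
      intro n hn
      have := hit h₂ he₂ n
      rw [hn, h₂0] at this
      exact mul_ne_zero (pow_ne_zero n hlam) hne this.symm
    have hlim : Tendsto (fun n => f^[n] x) atTop (𝓝[≠] 0) :=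
      tendsto_nhdsWithin_iff.2 ⟨tendsto_iterate_zero
        (hf.of_le (WithTop.coe_le_coe.2 le_top)) hmap' hf0 hdf hx, Eventually.of_forall hnz⟩
    have hconst : Tendsto (fun _ : ℕ => h₁ x / h₂ x) atTop (𝓝 1) := by
      refine ((tendsto_div_of_deriv_eq_one (hderiv h₁ hs₁ hd₁) (hderiv h₂ hs₂ hd₂) h₁0 h₂0).comp
        hlim).congr fun n => ?_
      simp only [Function.comp_apply, hit h₁ he₁ n, hit h₂ he₂ n]
      exact mul_div_mul_left _ _ (pow_ne_zero n hlam)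
    exact (div_eq_one_iff_eq hne).1 (tendsto_nhds_unique tendsto_const_nhds hconst)
end

section
/- Let J ⊂ ℝ be an open interval containing 0, ε₀ > 0, and ψ : J × [0,ε₀) → ℂ smooth with Re ψ > 0. Then for each sign ± there exist smooth complex-valued functions r^±, z^± on [0,ε₀) and q^± on J × [0,ε₀) with Re z^± > 0, z^±(0) = ψ(0,0), such that for all ε ∈ (0,ε₀) and x ∈ J: (x ± iεψ(x,ε))^{-1} = r^±(ε)(x ± iεz^±(ε))^{-1} + q^±(x,ε), and moreover 1 = x·q^±(x,0) + r^±(0). -/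
open Set

/-- The derivative of `G` within `S` in the direction `v`. -/
noncomputable def pderivWithin (S : Set (ℝ × ℝ)) (v : ℝ × ℝ) (G : ℝ × ℝ → ℂ) : ℝ × ℝ → ℂ :=
  fun p => fderivWithin ℝ G S p v

/-- `G` is smooth on `S` and its derivatives of order less than `n` vanish at the origin. -/
def VanishesToOrder (S : Set (ℝ × ℝ)) : ℕ → (ℝ × ℝ → ℂ) → Prop
  | 0, G => ContDiffOn ℝ (⊤ : ℕ∞) G S
  | n + 1, G => ContDiffOn ℝ (⊤ : ℕ∞) G S ∧ G 0 = 0 ∧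
      ∀ v, VanishesToOrder S n (pderivWithin S v G)

section Vanishing

variable {S : Set (ℝ × ℝ)} {G H : ℝ × ℝ → ℂ} {m n : ℕ}

theorem ContDiffOn.pderivWithin (hS : UniqueDiffOn ℝ S) (hG : ContDiffOn ℝ (⊤ : ℕ∞) G S)
    (v : ℝ × ℝ) : ContDiffOn ℝ (⊤ : ℕ∞) (pderivWithin S v G) S :=
  (hG.fderivWithin hS (by simp)).clm_apply contDiffOn_const

theorem ContDiffOn.differentiableOn_of_smooth (hG : ContDiffOn ℝ (⊤ : ℕ∞) G S) :
    DifferentiableOn ℝ G S :=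
  hG.differentiableOn (by simp)

theorem eqOn_pderivWithin_of_eqOn (h : EqOn G H S) (v : ℝ × ℝ) :
    EqOn (pderivWithin S v G) (pderivWithin S v H) S := fun p hp => by
  simp only [pderivWithin, fderivWithin_congr h (h hp)]

theorem eqOn_pderivWithin_add (hS : UniqueDiffOn ℝ S) (hG : DifferentiableOn ℝ G S)
    (hH : DifferentiableOn ℝ H S) (v : ℝ × ℝ) :
    EqOn (pderivWithin S v (G + H)) (pderivWithin S v G + pderivWithin S v H) S := fun p hp => by
  simp [pderivWithin, fderivWithin_add (hS p hp) (hG p hp) (hH p hp)]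

theorem eqOn_pderivWithin_sub (hS : UniqueDiffOn ℝ S) (hG : DifferentiableOn ℝ G S)
    (hH : DifferentiableOn ℝ H S) (v : ℝ × ℝ) :
    EqOn (pderivWithin S v (G - H)) (pderivWithin S v G - pderivWithin S v H) S := fun p hp => by
  simp [pderivWithin, fderivWithin_sub (hS p hp) (hG p hp) (hH p hp)]

theorem eqOn_pderivWithin_mul (hS : UniqueDiffOn ℝ S) (hG : DifferentiableOn ℝ G S)
    (hH : DifferentiableOn ℝ H S) (v : ℝ × ℝ) :
    EqOn (pderivWithin S v (G * H)) (pderivWithin S v G * H + G * pderivWithin S v H) S :=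
  fun p hp => by
    simp [pderivWithin, fderivWithin_mul (hS p hp) (hG p hp) (hH p hp)]
    ring

/-- Mixed directional derivatives of a smooth function commute. -/
theorem eqOn_pderivWithin_comm (hS : UniqueDiffOn ℝ S) (hcl : S ⊆ closure (interior S))
    (hG : ContDiffOn ℝ (⊤ : ℕ∞) G S) (v w : ℝ × ℝ) :
    EqOn (pderivWithin S v (pderivWithin S w G)) (pderivWithin S w (pderivWithin S v G)) S := by
  intro p hp
  have hd : DifferentiableWithinAt ℝ (fderivWithin ℝ G S) S p :=
    ((hG.fderivWithin (m := (⊤ : ℕ∞)) hS (by simp)).differentiableOn (by simp)) p hp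
  have key : ∀ u u' : ℝ × ℝ, pderivWithin S u (pderivWithin S u' G) p
      = fderivWithin ℝ (fderivWithin ℝ G S) S p u u' := by
    intro u u'
    have h := hd.hasFDerivWithinAt.clm_apply (hasFDerivWithinAt_const u' p S)
    have h' := h.fderivWithin (hS p hp)
    change fderivWithin ℝ (fun y => fderivWithin ℝ G S y u') S p u = _
    rw [h']
    simp
  rw [key, key]
  exact ((hG p hp).isSymmSndFDerivWithinAt
    (by simpa using WithTop.coe_le_coe.2 (le_top (a := (2 : ℕ∞)))) hS (hcl hp) hp).eq v w

theorem VanishesToOrder.contDiffOn (h : VanishesToOrder S n G) :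
    ContDiffOn ℝ (⊤ : ℕ∞) G S := by
  cases n with
  | zero => exact h
  | succ n => exact h.1

theorem VanishesToOrder.differentiableOn (h : VanishesToOrder S n G) : DifferentiableOn ℝ G S :=
  h.contDiffOn.differentiableOn_of_smooth

theorem VanishesToOrder.pderiv (hS : UniqueDiffOn ℝ S) (h : VanishesToOrder S n G)
    (v : ℝ × ℝ) : VanishesToOrder S (n - 1) (pderivWithin S v G) := by
  cases n with
  | zero => exact ContDiffOn.pderivWithin hS h v
  | succ n => exact h.2.2 v

theorem VanishesToOrder.apply_zero (h : VanishesToOrder S n G) (hn : n ≠ 0) : G 0 = 0 := by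
  cases n with
  | zero => exact absurd rfl hn
  | succ n => exact h.2.1

theorem VanishesToOrder.congr (h0 : (0 : ℝ × ℝ) ∈ S) (h : VanishesToOrder S n G)
    (hGH : EqOn H G S) : VanishesToOrder S n H := by
  induction n generalizing G H with
  | zero => exact ContDiffOn.congr h hGH
  | succ n ih =>
    exact ⟨h.1.congr hGH, (hGH h0).trans h.2.1,
      fun v => ih (h.2.2 v) (eqOn_pderivWithin_of_eqOn hGH v)⟩

theorem VanishesToOrder.of_le (hmn : m ≤ n) (h : VanishesToOrder S n G) :
    VanishesToOrder S m G := by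
  induction m generalizing n G with
  | zero => exact h.contDiffOn
  | succ m ih =>
    cases n with
    | zero => omega
    | succ n => exact ⟨h.1, h.2.1, fun v => ih (by omega) (h.2.2 v)⟩

theorem VanishesToOrder.add (hS : UniqueDiffOn ℝ S) (h0 : (0 : ℝ × ℝ) ∈ S)
    (hG : VanishesToOrder S n G) (hH : VanishesToOrder S n H) : VanishesToOrder S n (G + H) := by
  induction n generalizing G H with
  | zero => exact ContDiffOn.add hG hH
  | succ n ih =>
    exact ⟨hG.1.add hH.1, by simp [hG.2.1, hH.2.1], fun v => (ih (hG.2.2 v) (hH.2.2 v)).congr h0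
      (eqOn_pderivWithin_add hS hG.differentiableOn hH.differentiableOn v)⟩

theorem VanishesToOrder.sub (hS : UniqueDiffOn ℝ S) (h0 : (0 : ℝ × ℝ) ∈ S)
    (hG : VanishesToOrder S n G) (hH : VanishesToOrder S n H) : VanishesToOrder S n (G - H) := by
  induction n generalizing G H with
  | zero => exact ContDiffOn.sub hG hH
  | succ n ih =>
    exact ⟨hG.1.sub hH.1, by simp [hG.2.1, hH.2.1], fun v => (ih (hG.2.2 v) (hH.2.2 v)).congr h0
      (eqOn_pderivWithin_sub hS hG.differentiableOn hH.differentiableOn v)⟩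

theorem VanishesToOrder.mul (hS : UniqueDiffOn ℝ S) (h0 : (0 : ℝ × ℝ) ∈ S) {k : ℕ}
    (hk : k ≤ m + n) (hG : VanishesToOrder S m G) (hH : VanishesToOrder S n H) :
    VanishesToOrder S k (G * H) := by
  induction k generalizing m n G H with
  | zero => exact hG.contDiffOn.mul hH.contDiffOn
  | succ k ih =>
    refine ⟨hG.contDiffOn.mul hH.contDiffOn, ?_, fun v => ?_⟩
    · rcases Nat.eq_zero_or_pos m with rfl | hm
      · simp [hH.apply_zero (by omega)]
      · simp [hG.apply_zero hm.ne']
    · exact ((ih (by omega) (hG.pderiv hS v) hH).add hS h0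
        (ih (by omega) hG (hH.pderiv hS v))).congr h0
        (eqOn_pderivWithin_mul hS hG.differentiableOn hH.differentiableOn v)

theorem VanishesToOrder.pow (hS : UniqueDiffOn ℝ S) (h0 : (0 : ℝ × ℝ) ∈ S)
    (hG : VanishesToOrder S 1 G) (k : ℕ) : VanishesToOrder S k (G ^ k) := by
  induction k with
  | zero => exact contDiffOn_const (c := (1 : ℂ))
  | succ k ih => rw [pow_succ]; exact ih.mul hS h0 le_rfl hG

theorem VanishesToOrder.sum (hS : UniqueDiffOn ℝ S) (h0 : (0 : ℝ × ℝ) ∈ S) {ι : Type*}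
    {F : ι → ℝ × ℝ → ℂ} {s : Finset ι} (hF : ∀ i ∈ s, VanishesToOrder S n (F i)) :
    VanishesToOrder S n (∑ i ∈ s, F i) := by
  classical
  induction s using Finset.induction_on with
  | empty =>
    clear hF
    rw [Finset.sum_empty]
    induction n with
    | zero => exact contDiffOn_const
    | succ n ih =>
      refine ⟨contDiffOn_const, rfl, fun v => ?_⟩
      have : pderivWithin S v (0 : ℝ × ℝ → ℂ) = 0 := by
        ext p; simp [pderivWithin]
      rw [this]; exact ih
  | insert i s hi ih =>
    rw [Finset.sum_insert hi]
    exact (hF i (by simp)).add hS h0 (ih fun j hj => hF j (by simp [hj]))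

theorem vanishesToOrder_zero_const (c : ℂ) : VanishesToOrder S 0 (fun _ => c) :=
  contDiffOn_const

theorem VanishesToOrder.succ_of_partials (hS : UniqueDiffOn ℝ S) (h0 : (0 : ℝ × ℝ) ∈ S)
    (hG : ContDiffOn ℝ (⊤ : ℕ∞) G S) (hG0 : G 0 = 0)
    (h₁ : VanishesToOrder S n (pderivWithin S (1, 0) G))
    (h₂ : VanishesToOrder S n (pderivWithin S (0, 1) G)) :
    VanishesToOrder S (n + 1) G := by
  refine ⟨hG, hG0, fun v => ?_⟩
  refine (((vanishesToOrder_zero_const (v.1 : ℂ)).mul hS h0 (by omega) h₁).add hS h0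
    ((vanishesToOrder_zero_const (v.2 : ℂ)).mul hS h0 (by omega) h₂)).congr h0 fun p _ => ?_
  have hv : v = v.1 • ((1, 0) : ℝ × ℝ) + v.2 • ((0, 1) : ℝ × ℝ) := by ext <;> simp
  simp only [pderivWithin, Pi.add_apply, Pi.mul_apply]
  conv_lhs => rw [hv, map_add, map_smul, map_smul]
  simp

/-- A smooth function vanishing to order `n` at the origin is bounded by a multiple of
`‖p‖ ^ n` near the origin. -/
theorem VanishesToOrder.bound (hconv : Convex ℝ S)
    (h0 : (0 : ℝ × ℝ) ∈ S) (hG : VanishesToOrder S n G) :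
    ∃ C δ : ℝ, 0 < C ∧ 0 < δ ∧ ∀ p ∈ S, ‖p‖ < δ → ‖G p‖ ≤ C * ‖p‖ ^ n := by
  induction n generalizing G with
  | zero =>
    have hc := hG.contDiffOn.continuousOn.norm 0 h0
    have := hc.eventually_lt_const (lt_add_one ‖G 0‖)
    rw [eventually_nhdsWithin_iff, Metric.eventually_nhds_iff] at this
    obtain ⟨δ, hδ, h⟩ := this
    refine ⟨‖G 0‖ + 1, δ, by positivity, hδ, fun p hp hpδ => ?_⟩
    simpa using (h (by simpa using hpδ) hp).le
  | succ n ih =>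
    obtain ⟨C₁, δ₁, hC₁, hδ₁, h₁⟩ := ih (hG.2.2 (1, 0))
    obtain ⟨C₂, δ₂, hC₂, hδ₂, h₂⟩ := ih (hG.2.2 (0, 1))
    refine ⟨C₁ + C₂, min δ₁ δ₂, by positivity, lt_min hδ₁ hδ₂, fun p hp hpδ => ?_⟩
    have hconv' : Convex ℝ (S ∩ Metric.closedBall 0 ‖p‖) :=
      hconv.inter (convex_closedBall _ _)
    have hder : ∀ q ∈ S ∩ Metric.closedBall (0 : ℝ × ℝ) ‖p‖,
        HasFDerivWithinAt G (fderivWithin ℝ G S q) (S ∩ Metric.closedBall 0 ‖p‖) q :=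
      fun q hq => (hG.differentiableOn q hq.1).hasFDerivWithinAt.mono inter_subset_left
    have hbd : ∀ q ∈ S ∩ Metric.closedBall (0 : ℝ × ℝ) ‖p‖,
        ‖fderivWithin ℝ G S q‖ ≤ (C₁ + C₂) * ‖p‖ ^ n := by
      intro q hq
      have hqp : ‖q‖ ≤ ‖p‖ := by simpa using hq.2
      refine ContinuousLinearMap.opNorm_le_bound _ (by positivity) fun v => ?_
      have hv : v = v.1 • ((1, 0) : ℝ × ℝ) + v.2 • ((0, 1) : ℝ × ℝ) := by ext <;> simp
      have e : fderivWithin ℝ G S q v = v.1 • pderivWithin S (1, 0) G q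
          + v.2 • pderivWithin S (0, 1) G q := by
        simp only [pderivWithin]
        conv_lhs => rw [hv, map_add, map_smul, map_smul]
      have b₁ : ‖pderivWithin S (1, 0) G q‖ ≤ C₁ * ‖p‖ ^ n :=
        (h₁ q hq.1 (hqp.trans_lt (hpδ.trans_le (min_le_left _ _)))).trans (by gcongr)
      have b₂ : ‖pderivWithin S (0, 1) G q‖ ≤ C₂ * ‖p‖ ^ n :=
        (h₂ q hq.1 (hqp.trans_lt (hpδ.trans_le (min_le_right _ _)))).trans (by gcongr)
      have n₁ : ‖v.1‖ ≤ ‖v‖ := norm_fst_le v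
      have n₂ : ‖v.2‖ ≤ ‖v‖ := norm_snd_le v
      calc ‖fderivWithin ℝ G S q v‖ ≤ ‖v.1‖ * ‖pderivWithin S (1, 0) G q‖
            + ‖v.2‖ * ‖pderivWithin S (0, 1) G q‖ := by
            rw [e]; refine (norm_add_le _ _).trans (by rw [norm_smul, norm_smul])
        _ ≤ ‖v‖ * (C₁ * ‖p‖ ^ n) + ‖v‖ * (C₂ * ‖p‖ ^ n) := by gcongr
        _ = (C₁ + C₂) * ‖p‖ ^ n * ‖v‖ := by ring
    have := hconv'.norm_image_sub_le_of_norm_hasFDerivWithin_le hder hbd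
      (x := 0) (y := p) ⟨h0, by simp⟩ ⟨hp, by simp⟩
    rw [hG.2.1, sub_zero, sub_zero] at this
    rw [pow_succ, ← mul_assoc]
    exact this

end Vanishing

section LeadingTerm

variable {S : Set (ℝ × ℝ)} {G H : ℝ × ℝ → ℂ} {m n : ℕ}

theorem eqOn_pderivWithin_pow (hS : UniqueDiffOn ℝ S) (hG : DifferentiableOn ℝ G S) (k : ℕ)
    (v : ℝ × ℝ) :
    EqOn (pderivWithin S v (G ^ k)) (fun p => k * G p ^ (k - 1) * pderivWithin S v G p) S :=
  fun p hp => by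
    simp only [pderivWithin]
    have h : fderivWithin ℝ (G ^ k) S p = _ :=
      ((hG p hp).hasFDerivWithinAt.pow k).fderivWithin (hS p hp)
    rw [h]
    simp

theorem eqOn_pderivWithin_sum (hS : UniqueDiffOn ℝ S) {ι : Type*} {F : ι → ℝ × ℝ → ℂ}
    {s : Finset ι} (hF : ∀ i ∈ s, DifferentiableOn ℝ (F i) S) (v : ℝ × ℝ) :
    EqOn (pderivWithin S v (∑ i ∈ s, F i)) (∑ i ∈ s, pderivWithin S v (F i)) S :=
  fun p hp => by
    simp only [pderivWithin, Finset.sum_apply]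
    rw [fderivWithin_sum (hS p hp) fun i hi => hF i hi p hp]
    simp

/-- The coordinate function `(x, ε) ↦ x + κ ε`. -/
noncomputable def skewCoord (κ : ℂ) (p : ℝ × ℝ) : ℂ := p.1 + κ * p.2

/-- The coordinate function `(x, ε) ↦ ε`. -/
noncomputable def sndCoord (p : ℝ × ℝ) : ℂ := p.2

theorem contDiff_skewCoord (κ : ℂ) : ContDiff ℝ (⊤ : ℕ∞) (skewCoord κ) :=
  (Complex.ofRealCLM.contDiff.comp contDiff_fst).add
    (contDiff_const.mul (Complex.ofRealCLM.contDiff.comp contDiff_snd))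

theorem contDiff_sndCoord : ContDiff ℝ (⊤ : ℕ∞) sndCoord :=
  Complex.ofRealCLM.contDiff.comp contDiff_snd

theorem vanishesToOrder_one (hG : ContDiffOn ℝ (⊤ : ℕ∞) G S) (hS : UniqueDiffOn ℝ S)
    (hG0 : G 0 = 0) : VanishesToOrder S 1 G :=
  ⟨hG, hG0, fun v => ContDiffOn.pderivWithin hS hG v⟩

theorem vanishesToOrder_skewCoord (hS : UniqueDiffOn ℝ S) (κ : ℂ) :
    VanishesToOrder S 1 (skewCoord κ) :=
  vanishesToOrder_one (contDiff_skewCoord κ).contDiffOn hS (by simp [skewCoord])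

theorem vanishesToOrder_sndCoord (hS : UniqueDiffOn ℝ S) : VanishesToOrder S 1 sndCoord :=
  vanishesToOrder_one contDiff_sndCoord.contDiffOn hS (by simp [sndCoord])

theorem pderivWithin_skewCoord (hS : UniqueDiffOn ℝ S) (κ : ℂ) (v : ℝ × ℝ) :
    EqOn (pderivWithin S v (skewCoord κ)) (fun _ => v.1 + κ * v.2) S := fun p hp => by
  have h : HasFDerivAt (skewCoord κ)
      (Complex.ofRealCLM.comp (ContinuousLinearMap.fst ℝ ℝ ℝ)
        + κ • Complex.ofRealCLM.comp (ContinuousLinearMap.snd ℝ ℝ ℝ)) p :=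
    (Complex.ofRealCLM.comp (ContinuousLinearMap.fst ℝ ℝ ℝ)
        + κ • Complex.ofRealCLM.comp (ContinuousLinearMap.snd ℝ ℝ ℝ)).hasFDerivAt
  simp only [pderivWithin]
  rw [h.hasFDerivWithinAt.fderivWithin (hS p hp)]
  simp

theorem pderivWithin_sndCoord (hS : UniqueDiffOn ℝ S) (v : ℝ × ℝ) :
    EqOn (pderivWithin S v sndCoord) (fun _ => (v.2 : ℂ)) S := fun p hp => by
  have h : HasFDerivAt sndCoord (Complex.ofRealCLM.comp (ContinuousLinearMap.snd ℝ ℝ ℝ)) p :=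
    (Complex.ofRealCLM.comp (ContinuousLinearMap.snd ℝ ℝ ℝ)).hasFDerivAt
  simp only [pderivWithin]
  rw [h.hasFDerivWithinAt.fderivWithin (hS p hp)]
  simp

theorem eqOn_pderivWithin_const_mul (hS : UniqueDiffOn ℝ S) (hG : DifferentiableOn ℝ G S) (a : ℂ)
    (v : ℝ × ℝ) :
    EqOn (pderivWithin S v ((fun _ => a) * G)) ((fun _ => a) * pderivWithin S v G) S :=
  fun p hp => by
    rw [eqOn_pderivWithin_mul hS (differentiableOn_const a) hG v hp]
    simp [pderivWithin]

theorem VanishesToOrder.const_mul (hS : UniqueDiffOn ℝ S) (h0 : (0 : ℝ × ℝ) ∈ S) (a : ℂ)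
    (hG : VanishesToOrder S n G) : VanishesToOrder S n ((fun _ => a) * G) :=
  (vanishesToOrder_zero_const a).mul hS h0 (by omega) hG

/-- If `G` and its `x`-derivative vanish to order `n`, then the leading part of `G` is a multiple
of `ε ^ n`. -/
theorem VanishesToOrder.exists_sub_pow_snd (hS : UniqueDiffOn ℝ S)
    (hcl : S ⊆ closure (interior S)) (h0 : (0 : ℝ × ℝ) ∈ S) (hG : VanishesToOrder S n G)
    (hx : VanishesToOrder S n (pderivWithin S (1, 0) G)) :
    ∃ a : ℂ, VanishesToOrder S (n + 1) (G - (fun _ => a) * sndCoord ^ n) := by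
  induction n generalizing G with
  | zero =>
    refine ⟨G 0, vanishesToOrder_one ?_ hS (by simp)⟩
    exact hG.contDiffOn.sub (contDiffOn_const.mul (contDiff_sndCoord.contDiffOn.pow 0))
  | succ n ih =>
    obtain ⟨a, ha⟩ := ih (hG.2.2 (0, 1))
      ((hx.2.2 (0, 1)).congr h0 (eqOn_pderivWithin_comm hS hcl hG.1 _ _))
    have he := vanishesToOrder_sndCoord hS
    have hek := he.pow hS h0 (n + 1)
    have hek' := hek.const_mul hS h0 (a / (n + 1))
    refine ⟨a / (n + 1), VanishesToOrder.succ_of_partials hS h0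
      (hG.sub hS h0 hek').contDiffOn (by simp [hG.2.1, sndCoord]) ?_ ?_⟩
    · refine hx.congr h0 fun p hp => ?_
      rw [eqOn_pderivWithin_sub hS hG.differentiableOn hek'.differentiableOn _ hp, Pi.sub_apply,
        eqOn_pderivWithin_const_mul hS hek.differentiableOn _ _ hp, Pi.mul_apply,
        eqOn_pderivWithin_pow hS he.differentiableOn _ _ hp]
      simp [pderivWithin_sndCoord hS _ hp]
    · refine ha.congr h0 fun p hp => ?_
      rw [eqOn_pderivWithin_sub hS hG.differentiableOn hek'.differentiableOn _ hp, Pi.sub_apply,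
        eqOn_pderivWithin_const_mul hS hek.differentiableOn _ _ hp, Pi.mul_apply,
        eqOn_pderivWithin_pow hS he.differentiableOn _ _ hp]
      have hn : (n : ℂ) + 1 ≠ 0 := by exact_mod_cast n.succ_ne_zero
      simp [pderivWithin_sndCoord hS _ hp]
      field_simp

/-- The leading part of a smooth function vanishing to order `n` is a homogeneous polynomial of
degree `n` in `x + κ ε` and `ε`. -/
theorem VanishesToOrder.exists_leading (hS : UniqueDiffOn ℝ S)
    (hcl : S ⊆ closure (interior S)) (h0 : (0 : ℝ × ℝ) ∈ S) (κ : ℂ)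
    (hG : VanishesToOrder S n G) :
    ∃ c : ℕ → ℂ, VanishesToOrder S (n + 1)
      (G - ∑ i ∈ Finset.range (n + 1), (fun _ => c i) * (skewCoord κ ^ i * sndCoord ^ (n - i))) := by
  induction n generalizing G with
  | zero =>
    refine ⟨fun _ => G 0, vanishesToOrder_one ?_ hS (by simp)⟩
    simpa [Pi.sub_def] using hG.contDiffOn.sub contDiffOn_const
  | succ n ih =>
    obtain ⟨c, hc⟩ := ih (hG.2.2 (1, 0))
    have he := vanishesToOrder_sndCoord hS
    have hl := vanishesToOrder_skewCoord hS κ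
    have hmon : ∀ i ∈ Finset.range (n + 1),
        VanishesToOrder S (n + 1) (skewCoord κ ^ (i + 1) * sndCoord ^ (n - i)) := fun i hi =>
      (hl.pow hS h0 _).mul hS h0 (by have := Finset.mem_range.1 hi; omega) (he.pow hS h0 _)
    have hterm : ∀ i ∈ Finset.range (n + 1), VanishesToOrder S (n + 1)
        ((fun _ => c i / (i + 1)) * (skewCoord κ ^ (i + 1) * sndCoord ^ (n - i))) := fun i hi =>
      (hmon i hi).const_mul hS h0 _
    have hsum := VanishesToOrder.sum hS h0 hterm
    have hH := hG.sub hS h0 hsum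
    obtain ⟨a, ha⟩ := hH.exists_sub_pow_snd hS hcl h0 <| hc.congr h0 fun p hp => by
      rw [eqOn_pderivWithin_sub hS hG.differentiableOn hsum.differentiableOn _ hp, Pi.sub_apply,
        Pi.sub_apply, eqOn_pderivWithin_sum hS (fun i hi => (hterm i hi).differentiableOn) _ hp,
        Finset.sum_apply, Finset.sum_apply]
      congr 1
      refine Finset.sum_congr rfl fun i hi => ?_
      rw [eqOn_pderivWithin_const_mul hS (hmon i hi).differentiableOn _ _ hp, Pi.mul_apply,
        eqOn_pderivWithin_mul hS (hl.pow hS h0 _).differentiableOn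
          (he.pow hS h0 _).differentiableOn _ hp, Pi.add_apply, Pi.mul_apply, Pi.mul_apply,
        eqOn_pderivWithin_pow hS he.differentiableOn _ _ hp,
        eqOn_pderivWithin_pow hS hl.differentiableOn _ _ hp]
      have hi' : (i : ℂ) + 1 ≠ 0 := by exact_mod_cast i.succ_ne_zero
      simp [pderivWithin_sndCoord hS _ hp, pderivWithin_skewCoord hS _ _ hp]
      field_simp
    refine ⟨fun i => Nat.casesOn i a fun j => c j / (j + 1), ha.congr h0 fun p _ => ?_⟩
    rw [Finset.sum_range_succ' _ (n + 1)]
    simp [sub_sub]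

end LeadingTerm

section Quotient

variable {S : Set (ℝ × ℝ)} {G D : ℝ × ℝ → ℂ} {m n : ℕ}

theorem VanishesToOrder.isBigO_mul_inv_pow (hconv : Convex ℝ S)
    (h0 : (0 : ℝ × ℝ) ∈ S)
    (hlow : ∃ c δ : ℝ, 0 < c ∧ 0 < δ ∧ ∀ p ∈ S, ‖p‖ < δ → c * ‖p‖ ^ 2 ≤ ‖D p‖)
    (hn : n ≠ 0) (hG : VanishesToOrder S (2 * m + n) G) :
    (G * D⁻¹ ^ m) =O[nhdsWithin 0 S] fun p => ‖p - 0‖ ^ n := by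
  obtain ⟨C, δ, hC, hδ, hb⟩ := hG.bound hconv h0
  obtain ⟨c, δ', hc, hδ', hl⟩ := hlow
  refine Asymptotics.IsBigO.of_bound (C / c ^ m) ?_
  rw [eventually_nhdsWithin_iff, Metric.eventually_nhds_iff]
  refine ⟨min δ δ', lt_min hδ hδ', fun p hp hpS => ?_⟩
  rw [dist_zero_right] at hp
  have h₁ := hb p hpS (hp.trans_le (min_le_left _ _))
  have h₂ := hl p hpS (hp.trans_le (min_le_right _ _))
  rcases eq_or_ne p 0 with rfl | hp0
  · simp [hG.apply_zero (by omega), hn]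
  have hpos : 0 < ‖p‖ := norm_pos_iff.2 hp0
  have hDpos : 0 < ‖D p‖ := lt_of_lt_of_le (by positivity) h₂
  have h₃ : (c * ‖p‖ ^ 2) ^ m ≤ ‖D p‖ ^ m := by gcongr
  simp only [Pi.mul_apply, Pi.pow_apply, Pi.inv_apply, norm_mul, norm_pow, norm_inv, sub_zero,
    norm_norm]
  rw [inv_pow, ← div_eq_mul_inv, div_le_iff₀ (by positivity)]
  calc ‖G p‖ ≤ C * ‖p‖ ^ (2 * m + n) := h₁
    _ = C / c ^ m * ‖p‖ ^ n * (c * ‖p‖ ^ 2) ^ m := by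
      rw [mul_pow]; field_simp; ring
    _ ≤ _ := by gcongr

/-- The quotient of a function vanishing to order `2 m + n + 1` by the `m`-th power of a function
vanishing exactly to second order at the origin, and nowhere else, is of class `C ^ n`. -/
theorem VanishesToOrder.contDiffOn_mul_inv_pow (hS : UniqueDiffOn ℝ S) (hconv : Convex ℝ S)
    (h0 : (0 : ℝ × ℝ) ∈ S) (hD : VanishesToOrder S 2 D) (hne : ∀ p ∈ S, p ≠ 0 → D p ≠ 0)
    (hlow : ∃ c δ : ℝ, 0 < c ∧ 0 < δ ∧ ∀ p ∈ S, ‖p‖ < δ → c * ‖p‖ ^ 2 ≤ ‖D p‖)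
    (hG : VanishesToOrder S (2 * m + n + 1) G) : ContDiffOn ℝ n (G * D⁻¹ ^ m) S := by
  induction n generalizing m G with
  | zero =>
    rw [Nat.cast_zero, contDiffOn_zero]
    intro p hp
    rcases eq_or_ne p 0 with rfl | hp0
    · have hO := hG.isBigO_mul_inv_pow hconv h0 (n := 1) hlow one_ne_zero
      have hval : (G * D⁻¹ ^ m) 0 = 0 := by simp [hG.apply_zero (by omega)]
      rw [ContinuousWithinAt, hval]
      refine hO.trans_tendsto ?_
      have : Continuous fun p : ℝ × ℝ => ‖p - 0‖ ^ 1 := by fun_prop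
      simpa using (this.tendsto 0).mono_left nhdsWithin_le_nhds
    · exact (hG.contDiffOn.continuousOn p hp).mul
        (((hD.contDiffOn.continuousOn p hp).inv₀ (hne p hp hp0)).pow m)
  | succ n ih =>
    push_cast
    rw [contDiffOn_succ_iff_hasFDerivWithinAt_of_uniqueDiffOn hS]
    refine ⟨by simp, fun p => ((D⁻¹ ^ m) p) • fderivWithin ℝ G S p
      - (m * (G p * (D⁻¹ ^ (m + 1)) p)) • fderivWithin ℝ D S p, ?_, fun p hp => ?_⟩
    · rw [contDiffOn_clm_apply]
      intro v
      have h₁ := ih (m := m) ((hG.2.2 v).of_le (by omega))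
      have h₂ := ih (m := m + 1) (hG.mul hS h0 (by omega) (hD.pderiv hS v))
      refine (h₁.sub ((contDiffOn_const (c := (m : ℂ))).mul h₂)).congr fun p _ => ?_
      simp [pderivWithin]
      ring
    · rcases eq_or_ne p 0 with rfl | hp0
      · have hO := hG.isBigO_mul_inv_pow hconv h0 (n := n + 1 + 1) hlow (by omega)
        have hd : fderivWithin ℝ G S 0 = 0 := by
          refine ContinuousLinearMap.ext fun v => ?_
          exact (hG.2.2 v).apply_zero (by omega)
        have hz := hO.hasFDerivWithinAt (𝕜 := ℝ) h0 (by omega)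
        refine hz.congr_fderiv (ContinuousLinearMap.ext fun v => ?_)
        simp [hd, hG.apply_zero]
      · have hDp := hne p hp hp0
        have h₁ := (hG.differentiableOn p hp).hasFDerivWithinAt
        have h₂ := (hD.differentiableOn p hp).hasFDerivWithinAt
        have h₃ : HasDerivAt (fun w : ℂ => w⁻¹ ^ m)
            (m * (D p)⁻¹ ^ (m - 1) * (-(D p ^ 2)⁻¹)) (D p) := (hasDerivAt_inv hDp).pow m
        have h₄ := h₁.mul (h₃.comp_hasFDerivWithinAt p h₂)
        refine h₄.congr_fderiv ?_
        refine ContinuousLinearMap.ext fun v => ?_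
        rcases m with _ | m
        · simp
        · simp
          field_simp
          ring

end Quotient

section Borel

/-- Rescaled cut-off monomials `a t ^ i χ (L t)` have small derivatives of order less than `i`
when `L` is large. -/
theorem eventually_norm_iteratedFDeriv_cutoff_le {χ : ℝ → ℝ} (hχ : ContDiff ℝ (⊤ : ℕ∞) χ)
    (hsupp : HasCompactSupport χ) (a : ℂ) {i j : ℕ} (hij : j < i) {η : ℝ} (hη : 0 < η) :
    ∀ᶠ L : ℝ in Filter.atTop, ∀ t : ℝ,
      ‖iteratedFDeriv ℝ j (fun t : ℝ => a * ((t : ℂ) ^ i * (χ (L * t) : ℂ))) t‖ ≤ η := by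
  set g : ℝ → ℂ := fun t => (t : ℂ) ^ i * (χ t : ℂ) with hg
  have hgs : ContDiff ℝ (⊤ : ℕ∞) g :=
    (Complex.ofRealCLM.contDiff.pow i).mul (Complex.ofRealCLM.contDiff.comp hχ)
  have hgc : HasCompactSupport g :=
    (hsupp.comp_left (g := fun s : ℝ => (s : ℂ)) Complex.ofReal_zero).mul_left
  have hgj : HasCompactSupport (iteratedFDeriv ℝ j g) := hgc.iteratedFDeriv j
  obtain ⟨M, hM⟩ := hgj.exists_bound_of_continuous
    (hgs.continuous_iteratedFDeriv (by exact_mod_cast le_top))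
  have hM0 : 0 ≤ M := (norm_nonneg _).trans (hM 0)
  filter_upwards [Filter.eventually_ge_atTop (1 : ℝ), Filter.eventually_ge_atTop (‖a‖ * M / η)]
    with L hL hLη t
  have hL0 : 0 < L := by linarith
  have hfun : (fun t : ℝ => a * ((t : ℂ) ^ i * (χ (L * t) : ℂ)))
      = fun t => (a * (L : ℂ)⁻¹ ^ i) * g (L * t) := by
    ext t
    have : (L : ℂ) ≠ 0 := by exact_mod_cast hL0.ne'
    simp only [hg]
    push_cast
    rw [mul_pow, inv_pow]
    field_simp
  rw [norm_iteratedFDeriv_eq_norm_iteratedDeriv, hfun, iteratedDeriv_const_mul_field,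
    iteratedDeriv_comp_const_smul (hgs.of_le (by exact_mod_cast le_top))]
  have h₁ := hM (L * t)
  rw [norm_iteratedFDeriv_eq_norm_iteratedDeriv] at h₁
  have h₂ : L⁻¹ ^ i * L ^ j ≤ L⁻¹ := by
    obtain ⟨d, rfl⟩ : ∃ d, i = j + 1 + d := ⟨i - j - 1, by omega⟩
    have : L⁻¹ ^ d ≤ 1 := pow_le_one₀ (by positivity) (inv_le_one_of_one_le₀ hL)
    calc L⁻¹ ^ (j + 1 + d) * L ^ j = L⁻¹ * L⁻¹ ^ d := by
          rw [pow_add, pow_succ, inv_pow L j]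
          field_simp
      _ ≤ L⁻¹ * 1 := by gcongr
      _ = L⁻¹ := mul_one _
  have h₃ : ‖a‖ * M * L⁻¹ ≤ η := by
    rw [div_le_iff₀ hη] at hLη
    rw [← div_eq_mul_inv, div_le_iff₀ hL0]
    linarith
  simp only [norm_mul, norm_smul, norm_pow, norm_inv, Complex.norm_real, Real.norm_eq_abs,
    abs_of_pos hL0]
  calc ‖a‖ * L⁻¹ ^ i * (L ^ j * ‖iteratedDeriv j g (L * t)‖)
      ≤ ‖a‖ * L⁻¹ ^ i * (L ^ j * M) := by gcongr
    _ = ‖a‖ * M * (L⁻¹ ^ i * L ^ j) := by ring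
    _ ≤ ‖a‖ * M * L⁻¹ := by gcongr
    _ ≤ η := h₃

/-- A smooth function of one variable that vanishes near the origin is divisible by every power
of the variable. -/
theorem exists_contDiff_eq_pow_mul_of_eventually_eq_zero {g : ℝ → ℂ}
    (hg : ContDiff ℝ (⊤ : ℕ∞) g) (h : ∀ᶠ t in nhds (0 : ℝ), g t = 0) (n : ℕ) :
    ∃ w : ℝ → ℂ, ContDiff ℝ (⊤ : ℕ∞) w ∧ ∀ t : ℝ, g t = (t : ℂ) ^ n * w t := by
  refine ⟨fun t => g t * ((t : ℂ) ^ n)⁻¹, ?_, fun t => ?_⟩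
  · rw [contDiff_iff_contDiffAt]
    intro t
    rcases eq_or_ne t 0 with rfl | ht
    · refine contDiffAt_const (c := (0 : ℂ)) |>.congr_of_eventuallyEq ?_
      filter_upwards [h] with t ht
      simp [ht]
    · exact hg.contDiffAt.mul ((Complex.ofRealCLM.contDiff.contDiffAt.pow n).inv
        (by simpa using fun h' => absurd h' ht))
  · rcases eq_or_ne t 0 with rfl | ht
    · simp [h.self_of_nhds]
    · have : (t : ℂ) ≠ 0 := by exact_mod_cast ht
      field_simp

/-- **Borel's lemma**: every sequence is the sequence of Taylor coefficients at the origin of a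
smooth function. -/
theorem exists_contDiff_taylor_eq (a : ℕ → ℂ) :
    ∃ z : ℝ → ℂ, ContDiff ℝ (⊤ : ℕ∞) z ∧ ∀ n : ℕ, ∃ w : ℝ → ℂ, ContDiff ℝ (⊤ : ℕ∞) w ∧
      ∀ t : ℝ, z t = ∑ k ∈ Finset.range n, a k * (t : ℂ) ^ k + (t : ℂ) ^ n * w t := by
  let χ : ContDiffBump (0 : ℝ) := default
  have hχ : ContDiff ℝ (⊤ : ℕ∞) χ := χ.contDiff
  have hχ1 : ∀ᶠ t in nhds (0 : ℝ), χ t = 1 := χ.eventuallyEq_one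
  have hex : ∀ k : ℕ, ∃ L : ℝ, ∀ i ≤ k, ∀ j < i, ∀ t : ℝ,
      ‖iteratedFDeriv ℝ j (fun t : ℝ => a k * ((t : ℂ) ^ i * (χ (L * t) : ℂ))) t‖
        ≤ (1 / 2) ^ k := by
    intro k
    have : ∀ᶠ L : ℝ in Filter.atTop, ∀ i ∈ Finset.range (k + 1), ∀ j ∈ Finset.range i, ∀ t : ℝ,
        ‖iteratedFDeriv ℝ j (fun t : ℝ => a k * ((t : ℂ) ^ i * (χ (L * t) : ℂ))) t‖
          ≤ (1 / 2) ^ k := by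
      simp only [Filter.eventually_all_finset]
      intro i _ j hj
      exact eventually_norm_iteratedFDeriv_cutoff_le hχ χ.hasCompactSupport (a k)
        (Finset.mem_range.1 hj) (by positivity)
    obtain ⟨L, hL⟩ := this.exists
    exact ⟨L, fun i hi j hj => hL i (Finset.mem_range.2 (by omega)) j (Finset.mem_range.2 hj)⟩
  choose L hL using hex
  have hterm : ∀ k i : ℕ, ContDiff ℝ (⊤ : ℕ∞)
      (fun t : ℝ => a k * ((t : ℂ) ^ i * (χ (L k * t) : ℂ))) := fun k i =>
    contDiff_const.mul ((Complex.ofRealCLM.contDiff.pow i).mul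
      (Complex.ofRealCLM.contDiff.comp (hχ.comp (contDiff_const.mul contDiff_id))))
  have htail : ∀ n : ℕ, ContDiff ℝ (⊤ : ℕ∞)
      (fun t : ℝ => ∑' k, a (k + n) * ((t : ℂ) ^ k * (χ (L (k + n) * t) : ℂ))) := by
    intro n
    refine contDiff_tsum_of_eventually (N := (⊤ : ℕ∞)) (v := fun _ k => (1 / 2 : ℝ) ^ k)
      (fun k => hterm (k + n) k) (fun _ _ => summable_geometric_two) fun j _ => ?_
    rw [Nat.cofinite_eq_atTop]
    filter_upwards [Filter.eventually_gt_atTop j] with k hk t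
    exact (hL (k + n) k (by omega) j hk t).trans
      (pow_le_pow_of_le_one (by norm_num) (by norm_num) (by omega))
  have hsum : ∀ t : ℝ, Summable fun k => a k * ((t : ℂ) ^ k * (χ (L k * t) : ℂ)) := by
    intro t
    refine Summable.of_norm_bounded_eventually_nat summable_geometric_two ?_
    filter_upwards [Filter.eventually_gt_atTop 0] with k hk
    simpa using hL k k le_rfl 0 hk t
  have hhead : ∀ k n : ℕ, ∃ w : ℝ → ℂ, ContDiff ℝ (⊤ : ℕ∞) w ∧
      ∀ t : ℝ, (χ (L k * t) : ℂ) - 1 = (t : ℂ) ^ n * w t := by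
    intro k n
    refine exists_contDiff_eq_pow_mul_of_eventually_eq_zero
      ((Complex.ofRealCLM.contDiff.comp (hχ.comp (contDiff_const.mul contDiff_id))).sub
        contDiff_const) ?_ n
    have : Filter.Tendsto (fun t : ℝ => L k * t) (nhds 0) (nhds 0) := by
      simpa using (continuous_const_mul (L k)).tendsto 0
    filter_upwards [this.eventually hχ1] with t ht
    simp [ht]
  choose w hw hwe using hhead
  refine ⟨fun t => ∑' k, a k * ((t : ℂ) ^ k * (χ (L k * t) : ℂ)), by simpa using htail 0,
    fun n => ⟨fun t => ∑ k ∈ Finset.range n, a k * (t : ℂ) ^ k * w k n t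
      + ∑' k, a (k + n) * ((t : ℂ) ^ k * (χ (L (k + n) * t) : ℂ)), ?_, fun t => ?_⟩⟩
  · exact (ContDiff.sum fun k _ => (contDiff_const.mul (Complex.ofRealCLM.contDiff.pow k)).mul
      (hw k n)).add (htail n)
  · beta_reduce
    rw [← (hsum t).sum_add_tsum_nat_add n, mul_add, ← add_assoc, Finset.mul_sum,
      ← Finset.sum_add_distrib, ← tsum_mul_left]
    congr 1
    · refine Finset.sum_congr rfl fun k _ => ?_
      linear_combination a k * (t : ℂ) ^ k * hwe k n t
    · refine tsum_congr fun k => ?_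
      ring

/-- A version of Borel's lemma in which the function has positive real part everywhere. -/
theorem exists_contDiff_taylor_eq_of_re_pos (a : ℕ → ℂ) (ha : 0 < (a 0).re) :
    ∃ z : ℝ → ℂ, ContDiff ℝ (⊤ : ℕ∞) z ∧ (∀ t, 0 < (z t).re) ∧
      ∀ n : ℕ, ∃ w : ℝ → ℂ, ContDiff ℝ (⊤ : ℕ∞) w ∧
        ∀ t : ℝ, z t = ∑ k ∈ Finset.range n, a k * (t : ℂ) ^ k + (t : ℂ) ^ n * w t := by
  obtain ⟨z, hz, hzw⟩ := exists_contDiff_taylor_eq a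
  have hz0 : z 0 = a 0 := by
    obtain ⟨w, -, hw⟩ := hzw 1
    simpa using hw 0
  have hpos : ∀ᶠ t in nhds (0 : ℝ), 0 < (z t).re :=
    (Complex.continuous_re.comp hz.continuous).continuousAt.eventually_const_lt
      (by simpa [hz0] using ha)
  obtain ⟨δ, hδ, hball⟩ := Metric.eventually_nhds_iff.1 hpos
  let χ : ContDiffBump (0 : ℝ) := ⟨δ / 2, δ, by positivity, by linarith⟩
  have hχ : ContDiff ℝ (⊤ : ℕ∞) χ := χ.contDiff
  refine ⟨fun t => a 0 + χ t * (z t - a 0), ?_, fun t => ?_, fun n => ?_⟩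
  · exact contDiff_const.add ((Complex.ofRealCLM.contDiff.comp hχ).mul (hz.sub contDiff_const))
  · have hre : (a 0 + χ t * (z t - a 0)).re = (1 - χ t) * (a 0).re + χ t * (z t).re := by
      simp
      ring
    rw [hre]
    by_cases ht : dist t 0 < δ
    · have h₁ := hball ht
      rcases eq_or_lt_of_le (χ.nonneg (x := t)) with h₀ | h₀
      · rw [← h₀]; simpa using ha
      · have := mul_nonneg (sub_nonneg.2 (χ.le_one (x := t))) ha.le
        have := mul_pos h₀ h₁
        linarith
    · rw [χ.zero_of_le_dist (not_lt.1 ht)]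
      simpa using ha
  · obtain ⟨w, hw, hwe⟩ := hzw n
    obtain ⟨w', hw', hwe'⟩ := exists_contDiff_eq_pow_mul_of_eventually_eq_zero
      (g := fun t => (χ t - 1) * (z t - a 0))
      (((Complex.ofRealCLM.contDiff.comp hχ).sub contDiff_const).mul (hz.sub contDiff_const))
      (by filter_upwards [χ.eventuallyEq_one] with t ht; simp [ht]) n
    refine ⟨fun t => w t + w' t, hw.add hw', fun t => ?_⟩
    linear_combination hwe t + hwe' t

end Borel

section Preparation

variable {S : Set (ℝ × ℝ)} {φ : ℝ × ℝ → ℂ} {c : ℂ} {n : ℕ}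

/-- The function `(x, ε) ↦ x + c ε φ(x, ε)`. -/
noncomputable def perturbedCoord (c : ℂ) (φ : ℝ × ℝ → ℂ) (p : ℝ × ℝ) : ℂ :=
  p.1 + c * p.2 * φ p

theorem perturbedCoord_eq (c : ℂ) (φ : ℝ × ℝ → ℂ) :
    perturbedCoord c φ = skewCoord 0 + (fun _ => c) * sndCoord * φ := by
  ext p
  simp [perturbedCoord, skewCoord, sndCoord]

theorem vanishesToOrder_perturbedCoord (hS : UniqueDiffOn ℝ S) (h0 : (0 : ℝ × ℝ) ∈ S)
    (hφ : ContDiffOn ℝ (⊤ : ℕ∞) φ S) : VanishesToOrder S 1 (perturbedCoord c φ) := by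
  rw [perturbedCoord_eq]
  exact (vanishesToOrder_skewCoord hS 0).add hS h0
    (((vanishesToOrder_sndCoord hS).const_mul hS h0 c).mul hS h0 (n := 0) le_rfl hφ)

theorem vanishesToOrder_skewCoord_sub_perturbedCoord (hS : UniqueDiffOn ℝ S)
    (h0 : (0 : ℝ × ℝ) ∈ S) (hφ : ContDiffOn ℝ (⊤ : ℕ∞) φ S) :
    VanishesToOrder S 2 (skewCoord (c * φ 0) - perturbedCoord c φ) := by
  have h : VanishesToOrder S 1 ((fun _ => φ 0) - φ) :=
    vanishesToOrder_one (contDiffOn_const.sub hφ) hS (by simp)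
  refine (((vanishesToOrder_sndCoord hS).const_mul hS h0 c).mul hS h0 le_rfl h).congr h0
    fun p _ => ?_
  simp [skewCoord, perturbedCoord, sndCoord]
  ring

/-- The numerator `h - r f - q f h` of `f⁻¹ - r h⁻¹ - q`, where `f = x + c ε φ(x, ε)` and
`h = x + c ε z(ε)`. -/
noncomputable def divisionDefect (c : ℂ) (φ : ℝ × ℝ → ℂ) (z r : ℝ → ℂ) (q : ℝ × ℝ → ℂ)
    (p : ℝ × ℝ) : ℂ :=
  perturbedCoord c (fun p => z p.2) p - r p.2 * perturbedCoord c φ p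
    - q p * (perturbedCoord c φ p * perturbedCoord c (fun p => z p.2) p)

theorem contDiffOn_comp_snd {w : ℝ → ℂ} (hw : ContDiff ℝ (⊤ : ℕ∞) w) :
    ContDiffOn ℝ (⊤ : ℕ∞) (fun p : ℝ × ℝ => w p.2) S :=
  (hw.comp contDiff_snd).contDiffOn

/-- The order of vanishing of the defect does not change when `z` and `r` are modified by terms of
high order. -/
theorem VanishesToOrder.divisionDefect_congr (hS : UniqueDiffOn ℝ S) (h0 : (0 : ℝ × ℝ) ∈ S)
    (hφ : ContDiffOn ℝ (⊤ : ℕ∞) φ S) {z r z' r' w w' : ℝ → ℂ} {q : ℝ × ℝ → ℂ}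
    (hq : ContDiffOn ℝ (⊤ : ℕ∞) q S)
    (hw : ContDiff ℝ (⊤ : ℕ∞) w) (hw' : ContDiff ℝ (⊤ : ℕ∞) w')
    (hz : ∀ t : ℝ, z' t = z t + (t : ℂ) ^ n * w t)
    (hr : ∀ t : ℝ, r' t = r t + (t : ℂ) ^ n * w' t)
    (h : VanishesToOrder S (n + 1) (divisionDefect c φ z r q)) :
    VanishesToOrder S (n + 1) (divisionDefect c φ z' r' q) := by
  have he := vanishesToOrder_sndCoord hS
  have hf := vanishesToOrder_perturbedCoord (c := c) hS h0 hφ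
  have h₁ : VanishesToOrder S (n + 1) (((fun _ => c) * fun p => w p.2) * sndCoord ^ (n + 1)) :=
    VanishesToOrder.mul hS h0 (m := 0) (by omega)
      (contDiffOn_const.mul (contDiffOn_comp_snd hw)) (he.pow hS h0 (n + 1))
  have h₂ : VanishesToOrder S (n + 1) ((fun p => w' p.2) * (sndCoord ^ n * perturbedCoord c φ)) :=
    VanishesToOrder.mul hS h0 (m := 0) (by omega) (contDiffOn_comp_snd hw')
      ((he.pow hS h0 n).mul hS h0 le_rfl hf)
  have h₃ : VanishesToOrder S (n + 1) (q * perturbedCoord c φ *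
      (((fun _ => c) * fun p => w p.2) * sndCoord ^ (n + 1))) :=
    VanishesToOrder.mul hS h0 (m := 0) (by omega) (hq.mul hf.contDiffOn) h₁
  refine (((h.add hS h0 h₁).sub hS h0 h₂).sub hS h0 h₃).congr h0 fun p _ => ?_
  simp only [divisionDefect, perturbedCoord, sndCoord, Pi.add_apply, Pi.sub_apply, Pi.mul_apply,
    Pi.pow_apply, hz, hr]
  ring

/-- The inductive step of the formal division: the order of vanishing of the defect can be
increased by adding one monomial to each of `z` and `r`. -/
theorem VanishesToOrder.exists_divisionDefect_succ (hS : UniqueDiffOn ℝ S)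
    (hcl : S ⊆ closure (interior S)) (h0 : (0 : ℝ × ℝ) ∈ S)
    (hφ : ContDiffOn ℝ (⊤ : ℕ∞) φ S) (hc : c ≠ 0) {z r : ℝ → ℂ} {q : ℝ × ℝ → ℂ}
    (hz : ContDiff ℝ (⊤ : ℕ∞) z) (hz0 : z 0 = φ 0) (hq : ContDiffOn ℝ (⊤ : ℕ∞) q S)
    (h : VanishesToOrder S (n + 2) (divisionDefect c φ z r q)) :
    ∃ (α β : ℂ) (q' : ℝ × ℝ → ℂ), ContDiffOn ℝ (⊤ : ℕ∞) q' S ∧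
      VanishesToOrder S (n + 3) (divisionDefect c φ (fun t => z t + α * (t : ℂ) ^ (n + 1))
        (fun t => r t + β * (t : ℂ) ^ (n + 1)) q') := by
  obtain ⟨k, hk⟩ := h.exists_leading hS hcl h0 (c * φ 0)
  have he := vanishesToOrder_sndCoord hS
  have hl := vanishesToOrder_skewCoord hS (c * φ 0)
  have hf := vanishesToOrder_perturbedCoord (c := c) hS h0 hφ
  have hh : VanishesToOrder S 1 (perturbedCoord c fun p => z p.2) :=
    vanishesToOrder_perturbedCoord hS h0 (contDiffOn_comp_snd hz)
  have hlf := vanishesToOrder_skewCoord_sub_perturbedCoord (c := c) hS h0 hφ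
  have hlh : VanishesToOrder S 2 (skewCoord (c * φ 0) - perturbedCoord c fun p => z p.2) := by
    have := vanishesToOrder_skewCoord_sub_perturbedCoord (c := c) hS h0
      (contDiffOn_comp_snd (S := S) hz)
    simpa [hz0] using this
  set ℓ := skewCoord (c * φ 0)
  set f := perturbedCoord c φ with hf_def
  set Q : ℝ × ℝ → ℂ :=
    ∑ i ∈ Finset.range (n + 1), (fun _ => k (i + 2)) * (ℓ ^ i * sndCoord ^ (n - i)) with hQ
  have hQv : VanishesToOrder S n Q := VanishesToOrder.sum hS h0 fun i hi =>
    VanishesToOrder.const_mul hS h0 _ ((hl.pow hS h0 i).mul hS h0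
      (by have := Finset.mem_range.1 hi; omega) (he.pow hS h0 (n - i)))
  refine ⟨-k 0 / c, k 1, q + Q, hq.add hQv.contDiffOn, ?_⟩
  have h₁ : VanishesToOrder S (n + 3) ((fun _ => k 1) * (sndCoord ^ (n + 1) * (ℓ - f))) :=
    VanishesToOrder.const_mul hS h0 _ ((he.pow hS h0 (n + 1)).mul hS h0 (by omega) hlf)
  have h₂ : VanishesToOrder S (n + 3)
      (Q * (ℓ * (ℓ - perturbedCoord c fun p => z p.2)
        + (ℓ - f) * perturbedCoord c fun p => z p.2)) :=
    hQv.mul hS h0 le_rfl ((hl.mul hS h0 (k := 3) le_rfl hlh).add hS h0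
      (hlf.mul hS h0 le_rfl hh))
  have h₃ : VanishesToOrder S (n + 3)
      (((fun _ => k 0) * (q + Q)) * (f * sndCoord ^ (n + 2))) :=
    VanishesToOrder.mul hS h0 (m := 0) (n := n + 3) (by omega)
      (contDiffOn_const.mul (hq.add hQv.contDiffOn))
      (hf.mul hS h0 (by omega) (he.pow hS h0 (n + 2)))
  refine (((hk.add hS h0 h₁).add hS h0 h₂).add hS h0 h₃).congr h0 fun p _ => ?_
  have hsum : (∑ i ∈ Finset.range (n + 2 + 1),
      (fun _ => k i) * (ℓ ^ i * sndCoord ^ (n + 2 - i)) : ℝ × ℝ → ℂ) p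
      = k 0 * sndCoord p ^ (n + 2) + k 1 * (ℓ p * sndCoord p ^ (n + 1)) + Q p * ℓ p ^ 2 := by
    rw [Finset.sum_range_succ', Finset.sum_range_succ']
    simp only [hQ, Pi.add_apply, Pi.mul_apply, Pi.pow_apply, Finset.sum_apply, Finset.sum_mul]
    have hs : ∀ i ∈ Finset.range (n + 1),
        k (i + 1 + 1) * (ℓ p ^ (i + 1 + 1) * sndCoord p ^ (n + 2 - (i + 1 + 1)))
        = k (i + 2) * (ℓ p ^ i * sndCoord p ^ (n - i)) * ℓ p ^ 2 := by
      intro i _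
      rw [show n + 2 - (i + 1 + 1) = n - i by omega]
      ring
    rw [Finset.sum_congr rfl hs]
    simp
    ring
  have hα : perturbedCoord c (fun p => z p.2 + -k 0 / c * (p.2 : ℂ) ^ (n + 1)) p
      = perturbedCoord c (fun p => z p.2) p - k 0 * sndCoord p ^ (n + 2) := by
    simp only [perturbedCoord, sndCoord]
    field_simp
    ring
  simp only [Pi.add_apply, Pi.sub_apply, Pi.mul_apply, hsum, divisionDefect, hα, ← hf_def,
    Pi.pow_apply]
  rw [show (p.2 : ℂ) = sndCoord p from rfl]
  ring

/-- Formal division: there are sequences of Taylor coefficients for `z` and `r` whose truncations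
make the defect vanish to arbitrarily high order. -/
theorem exists_taylor_divisionDefect (hS : UniqueDiffOn ℝ S)
    (hcl : S ⊆ closure (interior S)) (h0 : (0 : ℝ × ℝ) ∈ S)
    (hφ : ContDiffOn ℝ (⊤ : ℕ∞) φ S) (hc : c ≠ 0) :
    ∃ (a b : ℕ → ℂ) (q : ℕ → ℝ × ℝ → ℂ), a 0 = φ 0 ∧ b 0 = 1 ∧ ∀ n,
      ContDiffOn ℝ (⊤ : ℕ∞) (q n) S ∧ VanishesToOrder S (n + 2) (divisionDefect c φ
        (fun t => ∑ k ∈ Finset.range (n + 1), a k * (t : ℂ) ^ k)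
        (fun t => ∑ k ∈ Finset.range (n + 1), b k * (t : ℂ) ^ k) (q n)) := by
  let P : ℕ → (ℝ → ℂ) × (ℝ → ℂ) × (ℝ × ℝ → ℂ) → Prop := fun n s =>
    ContDiff ℝ (⊤ : ℕ∞) s.1 ∧ s.1 0 = φ 0 ∧ ContDiffOn ℝ (⊤ : ℕ∞) s.2.2 S ∧
      VanishesToOrder S (n + 2) (divisionDefect c φ s.1 s.2.1 s.2.2)
  have step : ∀ n s, P n s → ∃ (α β : ℂ) (q' : ℝ × ℝ → ℂ),
      P (n + 1) (fun t => s.1 t + α * (t : ℂ) ^ (n + 1), fun t => s.2.1 t + β * (t : ℂ) ^ (n + 1),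
        q') := by
    rintro n ⟨z, r, q⟩ ⟨hz, hz0, hq, h⟩
    obtain ⟨α, β, q', hq', h'⟩ := h.exists_divisionDefect_succ hS hcl h0 hφ hc hz hz0 hq
    exact ⟨α, β, q', hz.add (contDiff_const.mul (Complex.ofRealCLM.contDiff.pow (n + 1))),
      by simpa using hz0, hq', h'⟩
  choose! α β q' hstep using step
  let s : ℕ → (ℝ → ℂ) × (ℝ → ℂ) × (ℝ × ℝ → ℂ) := fun n =>
    Nat.rec (fun _ => φ 0, fun _ => 1, fun _ => 0)
      (fun n s => (fun t => s.1 t + α n s * (t : ℂ) ^ (n + 1),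
        fun t => s.2.1 t + β n s * (t : ℂ) ^ (n + 1), q' n s)) n
  have hs : ∀ n, P n (s n) := by
    intro n
    induction n with
    | zero =>
      refine ⟨contDiff_const, rfl, contDiffOn_const, ?_⟩
      refine (vanishesToOrder_skewCoord_sub_perturbedCoord (c := c) hS h0 hφ).congr h0 fun p _ => ?_
      simp [s, divisionDefect, perturbedCoord, skewCoord]
      ring
    | succ n ih => exact hstep n (s n) ih
  let a : ℕ → ℂ := fun k => Nat.casesOn k (φ 0) fun k => α k (s k)
  let b : ℕ → ℂ := fun k => Nat.casesOn k 1 fun k => β k (s k)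
  have ha : ∀ n, (s n).1 = fun t : ℝ => ∑ k ∈ Finset.range (n + 1), a k * (t : ℂ) ^ k := by
    intro n
    induction n with
    | zero => ext t; simp [s, a]
    | succ n ih => ext t; rw [Finset.sum_range_succ, ← congrFun ih t]
  have hb : ∀ n, (s n).2.1 = fun t : ℝ => ∑ k ∈ Finset.range (n + 1), b k * (t : ℂ) ^ k := by
    intro n
    induction n with
    | zero => ext t; simp [s, b]
    | succ n ih => ext t; rw [Finset.sum_range_succ, ← congrFun ih t]
  refine ⟨a, b, fun n => (s n).2.2, rfl, rfl, fun n => ⟨(hs n).2.2.1, ?_⟩⟩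
  rw [← ha, ← hb]
  exact (hs n).2.2.2

theorem perturbedCoord_ne_zero {σ : ℝ} (hσ : |σ| = 1) {p : ℝ × ℝ} (hp : p ≠ 0)
    (hre : 0 < (φ p).re) : perturbedCoord (σ * Complex.I) φ p ≠ 0 := by
  intro h
  have him : p.2 = 0 := by
    have := congrArg Complex.im h
    have hσ0 : σ ≠ 0 := by rintro rfl; simp at hσ
    simpa [perturbedCoord, hσ0, hre.ne'] using this
  have hx : p.1 = 0 := by simpa [perturbedCoord, him] using h
  exact hp (Prod.ext hx him)

/-- The function `x ± i ε φ(x, ε)` vanishes exactly to first order at the origin. -/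
theorem exists_le_norm_perturbedCoord {σ : ℝ} (hσ : |σ| = 1) (h0 : (0 : ℝ × ℝ) ∈ S)
    (hpos : ∀ p ∈ S, 0 ≤ p.2) (hφ : ContinuousOn φ S) (hre : 0 < (φ 0).re) :
    ∃ k δ : ℝ, 0 < k ∧ 0 < δ ∧ ∀ p ∈ S, ‖p‖ < δ →
      k * ‖p‖ ≤ ‖perturbedCoord (σ * Complex.I) φ p‖ := by
  have h₁ : ∀ᶠ p in nhdsWithin 0 S, (φ 0).re / 2 < (φ p).re :=
    (Complex.continuous_re.continuousAt.comp_continuousWithinAt (hφ 0 h0)).eventually_const_lt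
      (half_lt_self hre)
  have h₂ : ∀ᶠ p in nhdsWithin 0 S, ‖φ p‖ < ‖φ 0‖ + 1 :=
    (hφ 0 h0).norm.eventually_lt_const (lt_add_one _)
  have h₁₂ := h₁.and h₂
  rw [eventually_nhdsWithin_iff, Metric.eventually_nhds_iff] at h₁₂
  obtain ⟨δ, hδ, hb⟩ := h₁₂
  set ρ := (φ 0).re / 2 with hρ_def
  set K := ‖φ 0‖ + 1 with hK_def
  have hρ : 0 < ρ := half_pos hre
  have hK : 0 < K := by positivity
  refine ⟨(1 / ρ + 1 + K / ρ)⁻¹, δ, by positivity, hδ, fun p hp hpδ => ?_⟩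
  obtain ⟨hr, hn⟩ := hb (by simpa using hpδ) hp
  have hε := hpos p hp
  set d := ‖perturbedCoord (σ * Complex.I) φ p‖ with hd
  have hre' : (perturbedCoord (σ * Complex.I) φ p).re = p.1 - σ * p.2 * (φ p).im := by
    simp [perturbedCoord]
    ring
  have him' : (perturbedCoord (σ * Complex.I) φ p).im = σ * p.2 * (φ p).re := by
    simp [perturbedCoord]
  have b₁ : p.2 * ρ ≤ d := by
    have := Complex.abs_im_le_norm (perturbedCoord (σ * Complex.I) φ p)
    rw [him', abs_mul, abs_mul, hσ, abs_of_nonneg hε, abs_of_pos (hρ.trans hr), one_mul] at this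
    exact (mul_le_mul_of_nonneg_left hr.le hε).trans this
  have b₂ : p.2 ≤ d / ρ := (le_div_iff₀ hρ).2 b₁
  have b₃ : |p.1| ≤ d + K * (d / ρ) := by
    have h := Complex.abs_re_le_norm (perturbedCoord (σ * Complex.I) φ p)
    rw [hre'] at h
    have h' : |σ * p.2 * (φ p).im| ≤ K * (d / ρ) := by
      rw [abs_mul, abs_mul, hσ, abs_of_nonneg hε, one_mul, mul_comm]
      exact mul_le_mul ((Complex.abs_im_le_norm _).trans hn.le) b₂ hε hK.le
    have := abs_sub_abs_le_abs_sub p.1 (σ * p.2 * (φ p).im)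
    linarith
  have hd0 : 0 ≤ d := norm_nonneg _
  rw [inv_mul_le_iff₀ (by positivity), Prod.norm_def, max_le_iff, Real.norm_eq_abs,
    Real.norm_eq_abs, abs_of_nonneg hε]
  have e : (1 / ρ + 1 + K / ρ) * d = d / ρ + (d + K * (d / ρ)) := by ring
  have : 0 ≤ d / ρ := by positivity
  have : 0 ≤ K * (d / ρ) := by positivity
  rw [e]
  constructor <;> linarith

/-- If the defects of a family of smooth functions `q n` vanish to arbitrarily high order, then
any of them can be corrected to give an exact smooth division. -/
theorem exists_contDiffOn_div_of_divisionDefect (hS : UniqueDiffOn ℝ S) (hconv : Convex ℝ S)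
    (h0 : (0 : ℝ × ℝ) ∈ S) [(nhdsWithin (0 : ℝ × ℝ) (S \ {0})).NeBot]
    {N D : ℝ × ℝ → ℂ} (hD : VanishesToOrder S 2 D) (hne : ∀ p ∈ S, p ≠ 0 → D p ≠ 0)
    (hlow : ∃ c δ : ℝ, 0 < c ∧ 0 < δ ∧ ∀ p ∈ S, ‖p‖ < δ → c * ‖p‖ ^ 2 ≤ ‖D p‖)
    {q : ℕ → ℝ × ℝ → ℂ} (hq : ∀ n, ContDiffOn ℝ (⊤ : ℕ∞) (q n) S)
    (hN : ∀ n, VanishesToOrder S n (N - q n * D)) :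
    ∃ g : ℝ × ℝ → ℂ, ContDiffOn ℝ (⊤ : ℕ∞) g S ∧ ∀ p ∈ S, p ≠ 0 → N p = g p * D p := by
  let u : ℕ → ℝ × ℝ → ℂ := fun n => q (2 * 1 + n + 1) + (N - q (2 * 1 + n + 1) * D) * D⁻¹ ^ 1
  have hu : ∀ n : ℕ, ContDiffOn ℝ n (u n) S := fun n =>
    ((hq _).of_le (by exact_mod_cast le_top)).add
      (hD.contDiffOn_mul_inv_pow hS hconv h0 hne hlow (hN (2 * 1 + n + 1)))
  have hform : ∀ n, ∀ p ∈ S, p ≠ 0 → u n p = N p / D p := by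
    intro n p hp hp0
    have := hne p hp hp0
    simp only [u, Pi.add_apply, Pi.mul_apply, Pi.sub_apply, Pi.pow_apply, Pi.inv_apply]
    field_simp
    ring
  have huu : ∀ n, EqOn (u 0) (u n) S := by
    intro n p hp
    rcases eq_or_ne p 0 with rfl | hp0
    · have t₁ : Filter.Tendsto (u 0) (nhdsWithin 0 (S \ {0})) (nhds (u 0 0)) :=
        ((hu 0).continuousOn 0 h0).mono_left (nhdsWithin_mono _ sdiff_subset)
      have t₂ : Filter.Tendsto (u n) (nhdsWithin 0 (S \ {0})) (nhds (u n 0)) :=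
        ((hu n).continuousOn 0 h0).mono_left (nhdsWithin_mono _ sdiff_subset)
      refine tendsto_nhds_unique t₁ (t₂.congr' ?_)
      filter_upwards [self_mem_nhdsWithin] with p hp
      rw [hform n p hp.1 hp.2, hform 0 p hp.1 hp.2]
    · rw [hform n p hp hp0, hform 0 p hp hp0]
  refine ⟨u 0, contDiffOn_infty.2 fun n => (hu n).congr (huu n), fun p hp hp0 => ?_⟩
  rw [hform 0 p hp hp0, div_mul_cancel₀ _ (hne p hp hp0)]

end Preparation

/-- Let `J = (a,b) ∋ 0`, `ε₀ > 0`, `ψ : J × [0,ε₀) → ℂ` smooth with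
`Re ψ > 0`. Then for each sign `σ = ±1` there exist smooth `r, z` on `[0,ε₀)` and `q` on
`J × [0,ε₀)`, with `Re z > 0`, `z(0) = ψ(0,0)`, such that for `ε ∈ (0,ε₀)` and `x ∈ J`:
`(x + σiεψ(x,ε))⁻¹ = r(ε)(x + σiεz(ε))⁻¹ + q(x,ε)`, and `1 = x·q(x,0) + r(0)`. -/
theorem stmt9 (a b ε₀ : ℝ) (ha : a < 0) (hb : 0 < b) (hε₀ : 0 < ε₀)
    (ψ : ℝ → ℝ → ℂ)
    (hψ : ContDiffOn ℝ (⊤ : ℕ∞) (fun p : ℝ × ℝ => ψ p.1 p.2) (Ioo a b ×ˢ Ico 0 ε₀))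
    (hre : ∀ x ∈ Ioo a b, ∀ ε ∈ Ico (0 : ℝ) ε₀, 0 < (ψ x ε).re)
    (σ : ℝ) (hσ : σ = 1 ∨ σ = -1) :
    ∃ r z : ℝ → ℂ, ∃ q : ℝ → ℝ → ℂ,
      ContDiffOn ℝ (⊤ : ℕ∞) r (Ico 0 ε₀) ∧ ContDiffOn ℝ (⊤ : ℕ∞) z (Ico 0 ε₀) ∧
      ContDiffOn ℝ (⊤ : ℕ∞) (fun p : ℝ × ℝ => q p.1 p.2) (Ioo a b ×ˢ Ico 0 ε₀) ∧
      (∀ ε ∈ Ico (0 : ℝ) ε₀, 0 < (z ε).re) ∧ z 0 = ψ 0 0 ∧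
      (∀ ε ∈ Ioo (0 : ℝ) ε₀, ∀ x ∈ Ioo a b,
        ((x : ℂ) + (σ : ℂ) * Complex.I * (ε : ℂ) * ψ x ε)⁻¹
          = r ε * ((x : ℂ) + (σ : ℂ) * Complex.I * (ε : ℂ) * z ε)⁻¹ + q x ε) ∧
      ∀ x ∈ Ioo a b, (1 : ℂ) = (x : ℂ) * q x 0 + r 0 := by
  set S : Set (ℝ × ℝ) := Ioo a b ×ˢ Ico 0 ε₀ with hS_def
  set φ : ℝ × ℝ → ℂ := fun p => ψ p.1 p.2 with hφ_def
  have h0 : (0 : ℝ × ℝ) ∈ S := ⟨⟨ha, hb⟩, ⟨le_rfl, hε₀⟩⟩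
  have hconv : Convex ℝ S := (convex_Ioo a b).prod (convex_Ico 0 ε₀)
  have hint : (interior S).Nonempty := by
    rw [hS_def, interior_prod_eq, interior_Ioo, interior_Ico]
    exact ⟨(0, ε₀ / 2), ⟨ha, hb⟩, by simpa using hε₀, by simpa using hε₀⟩
  have hS : UniqueDiffOn ℝ S := uniqueDiffOn_convex hconv hint
  have hcl : S ⊆ closure (interior S) := by
    rw [hconv.closure_interior_eq_closure_of_nonempty_interior hint]
    exact subset_closure
  have hpos : ∀ p ∈ S, 0 ≤ p.2 := fun p hp => hp.2.1
  have hreφ : ∀ p ∈ S, 0 < (φ p).re := fun p hp => hre _ hp.1 _ hp.2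
  have hσ1 : |σ| = 1 := by rcases hσ with rfl | rfl <;> simp
  have hc : (σ : ℂ) * Complex.I ≠ 0 := by
    rcases hσ with rfl | rfl <;> simp
  have : (nhdsWithin (0 : ℝ × ℝ) (S \ {0})).NeBot := by
    have hseq : Filter.Tendsto (fun ε : ℝ => ((0 : ℝ), ε)) (nhdsWithin 0 (Ioi 0))
        (nhdsWithin (0 : ℝ × ℝ) (S \ {0})) := by
      refine tendsto_nhdsWithin_iff.2 ⟨?_, ?_⟩
      · exact (((continuous_const.prodMk continuous_id).tendsto (0 : ℝ)).mono_left
          nhdsWithin_le_nhds)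
      · filter_upwards [Ioo_mem_nhdsGT hε₀] with ε hε
        exact ⟨⟨⟨ha, hb⟩, hε.1.le, hε.2⟩, fun h => hε.1.ne' (congrArg Prod.snd h)⟩
    exact hseq.neBot
  obtain ⟨A, B, Q, hA0, hB0, hQ⟩ := exists_taylor_divisionDefect hS hcl h0 hψ hc
  obtain ⟨z, hz, hzre, hzt⟩ := exists_contDiff_taylor_eq_of_re_pos A (by rw [hA0]; exact hreφ 0 h0)
  obtain ⟨r, hr, hrt⟩ := exists_contDiff_taylor_eq B
  have hz0 : z 0 = ψ 0 0 := by
    obtain ⟨w, -, hw⟩ := hzt 1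
    simpa [hA0, hφ_def] using hw 0
  have hr0 : r 0 = 1 := by
    obtain ⟨w, -, hw⟩ := hrt 1
    simpa [hB0] using hw 0
  have hzS : ContDiffOn ℝ (⊤ : ℕ∞) (fun p : ℝ × ℝ => z p.2) S := contDiffOn_comp_snd hz
  set f := perturbedCoord (σ * Complex.I) φ with hf_def
  set h := perturbedCoord (σ * Complex.I) fun p => z p.2 with hh_def
  have hfne : ∀ p ∈ S, p ≠ 0 → f p ≠ 0 := fun p hp hp0 =>
    perturbedCoord_ne_zero hσ1 hp0 (hreφ p hp)
  have hhne : ∀ p ∈ S, p ≠ 0 → h p ≠ 0 := fun p hp hp0 =>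
    perturbedCoord_ne_zero hσ1 hp0 (hzre p.2)
  have hlow : ∃ c δ : ℝ, 0 < c ∧ 0 < δ ∧ ∀ p ∈ S, ‖p‖ < δ → c * ‖p‖ ^ 2 ≤ ‖(f * h) p‖ := by
    obtain ⟨k₁, δ₁, hk₁, hδ₁, h₁⟩ :=
      exists_le_norm_perturbedCoord hσ1 h0 hpos hψ.continuousOn (hreφ 0 h0)
    obtain ⟨k₂, δ₂, hk₂, hδ₂, h₂⟩ :=
      exists_le_norm_perturbedCoord hσ1 h0 hpos hzS.continuousOn (hzre 0)
    refine ⟨k₁ * k₂, min δ₁ δ₂, by positivity, lt_min hδ₁ hδ₂, fun p hp hpδ => ?_⟩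
    rw [Pi.mul_apply, norm_mul]
    calc k₁ * k₂ * ‖p‖ ^ 2 = k₁ * ‖p‖ * (k₂ * ‖p‖) := by ring
      _ ≤ ‖f p‖ * ‖h p‖ := mul_le_mul (h₁ p hp (hpδ.trans_le (min_le_left _ _)))
          (h₂ p hp (hpδ.trans_le (min_le_right _ _))) (by positivity) (norm_nonneg _)
  have hD : VanishesToOrder S 2 (f * h) := (vanishesToOrder_perturbedCoord hS h0 hψ).mul hS h0
    le_rfl (vanishesToOrder_perturbedCoord hS h0 hzS)
  have hdefect : ∀ n, VanishesToOrder S n ((fun p => h p - r p.2 * f p) - Q n * (f * h)) := by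
    intro n
    obtain ⟨w, hw, hzw⟩ := hzt (n + 1)
    obtain ⟨w', hw', hrw⟩ := hrt (n + 1)
    exact ((hQ n).2.divisionDefect_congr hS h0 hψ (hQ n).1 hw hw' hzw hrw).of_le (by omega)
  obtain ⟨g, hg, hgq⟩ := exists_contDiffOn_div_of_divisionDefect hS hconv h0 hD
    (fun p hp hp0 => mul_ne_zero (hfne p hp hp0) (hhne p hp hp0)) hlow (fun n => (hQ n).1) hdefect
  refine ⟨r, z, fun x ε => g (x, ε), hr.contDiffOn, hz.contDiffOn, hg, fun ε _ => hzre ε, hz0,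
    fun ε hε x hx => ?_, fun x hx => ?_⟩
  · have hp : (x, ε) ∈ S := ⟨hx, hε.1.le, hε.2⟩
    have hp0 : (x, ε) ≠ 0 := fun h => hε.1.ne' (congrArg Prod.snd h)
    have hf := hfne _ hp hp0
    have hh := hhne _ hp hp0
    have key := hgq _ hp hp0
    change (f (x, ε))⁻¹ = r ε * (h (x, ε))⁻¹ + g (x, ε)
    simp only [Pi.mul_apply] at key
    field_simp
    linear_combination key
  · rcases eq_or_ne x 0 with rfl | hx0
    · simp [hr0]
    have hp : (x, (0 : ℝ)) ∈ S := ⟨hx, le_rfl, hε₀⟩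
    have key := hgq _ hp fun h => hx0 (congrArg Prod.fst h)
    have hxc : (x : ℂ) ≠ 0 := by exact_mod_cast hx0
    simp only [hf_def, hh_def, perturbedCoord, Pi.mul_apply, Complex.ofReal_zero, mul_zero,
      zero_mul, add_zero] at key
    refine mul_right_cancel₀ hxc ?_
    linear_combination key
end

section
/- Let J ⊂ ℝ be an open interval containing 0 and ψ : J × [0,ε₀) → ℂ smooth with Re ψ > 0. Then (x ± iψ(x,ε))^{-1} → (x ± i0)^{-1} as ε → 0⁺ in H^s_loc(J) for every s < −1/2. -/
open Set MeasureTheory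

/-- The Fourier integral with the angular-frequency normalisation `∫ exp (-ixξ) g(x) dx`. -/
noncomputable def angularFourier (g : ℝ → ℂ) (ξ : ℝ) : ℂ :=
  ∫ x : ℝ, Complex.exp (-Complex.I * (x : ℂ) * (ξ : ℂ)) * g x

lemma norm_exp_neg_I_mul_mul (x ξ : ℝ) :
    ‖Complex.exp (-Complex.I * (x : ℂ) * (ξ : ℂ))‖ = 1 := by
  simp [Complex.norm_exp]

lemma integrable_exp_mul {g : ℝ → ℂ} (hg : Integrable g) (ξ : ℝ) :
    Integrable fun x : ℝ => Complex.exp (-Complex.I * (x : ℂ) * (ξ : ℂ)) * g x := by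
  refine hg.norm.mono' (Continuous.aestronglyMeasurable (by fun_prop) |>.mul
    hg.aestronglyMeasurable) (Filter.Eventually.of_forall fun x => ?_)
  rw [norm_mul, norm_exp_neg_I_mul_mul, one_mul]

lemma norm_angularFourier_le (g : ℝ → ℂ) (ξ : ℝ) : ‖angularFourier g ξ‖ ≤ ∫ x, ‖g x‖ := by
  refine (norm_integral_le_integral_norm _).trans_eq ?_
  simp_rw [norm_mul, norm_exp_neg_I_mul_mul, one_mul]

lemma continuous_angularFourier {g : ℝ → ℂ} (hg : Integrable g) :
    Continuous (angularFourier g) := by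
  refine continuous_of_dominated (fun ξ => (integrable_exp_mul hg ξ).aestronglyMeasurable)
    (fun ξ => Filter.Eventually.of_forall fun x => ?_) hg.norm
    (Filter.Eventually.of_forall fun x => by fun_prop)
  rw [norm_mul, norm_exp_neg_I_mul_mul, one_mul]

lemma angularFourier_sub {f g : ℝ → ℂ} (hf : Integrable f) (hg : Integrable g) (ξ : ℝ) :
    angularFourier f ξ - angularFourier g ξ = angularFourier (fun x => f x - g x) ξ := by
  unfold angularFourier
  rw [← integral_sub (integrable_exp_mul hf ξ) (integrable_exp_mul hg ξ)]
  simp_rw [mul_sub]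

open scoped FourierTransform in
lemma integrable_angularFourier {χ : ℝ → ℂ} (hχ : ContDiff ℝ (⊤ : ℕ∞) χ)
    (hχc : HasCompactSupport χ) : Integrable (angularFourier χ) := by
  have h := (𝓕 (hχc.toSchwartzMap hχ)).integrable (μ := volume)
  refine (h.comp_div (R := 2 * Real.pi) (by positivity)).congr
    (Filter.Eventually.of_forall fun ξ => ?_)
  simp only [SchwartzMap.fourier_coe]
  rw [Real.fourier_real_eq_integral_exp_smul]
  refine integral_congr_ae (Filter.Eventually.of_forall fun x => ?_)
  simp only [HasCompactSupport.toSchwartzMap_toFun, smul_eq_mul]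
  congr 2
  have : (Real.pi : ℂ) ≠ 0 := by exact_mod_cast Real.pi_ne_zero
  push_cast
  field_simp

lemma inv_eq_integral_exp {σ : ℝ} (hσ : σ = 1 ∨ σ = -1) (x : ℝ) {w : ℂ} (hw : 0 < w.re) :
    ((x : ℂ) + σ * Complex.I * w)⁻¹ =
      -(σ : ℂ) * Complex.I *
        ∫ η in Ioi (0 : ℝ), Complex.exp ((σ * Complex.I * x - w) * (η : ℂ)) := by
  have hre : ((σ : ℂ) * Complex.I * x - w).re < 0 := by simpa using hw
  have h0 : (σ : ℂ) * Complex.I * x - w ≠ 0 := fun h => by simp [h] at hre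
  have hσ2 : (σ : ℂ) * σ = 1 := by rcases hσ with rfl | rfl <;> norm_num
  rw [integral_exp_mul_complex_Ioi hre]
  have e : (x : ℂ) + σ * Complex.I * w = -(σ * Complex.I) * (σ * Complex.I * x - w) := by
    linear_combination (-(x : ℂ)) * hσ2 + ((σ : ℂ) * σ * x) * Complex.I_mul_I
  rw [e]
  refine inv_eq_of_mul_eq_one_right ?_
  simp only [Complex.ofReal_zero, mul_zero, Complex.exp_zero]
  field_simp
  linear_combination (-(σ : ℂ) ^ 2) * Complex.I_sq + hσ2

lemma angularFourier_mul_inv {χ : ℝ → ℂ} (hχ : Integrable χ) {σ : ℝ} (hσ : σ = 1 ∨ σ = -1)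
    {w : ℂ} (hw : 0 < w.re) (ξ : ℝ) :
    angularFourier (fun x => χ x * ((x : ℂ) + σ * Complex.I * w)⁻¹) ξ =
      -(σ : ℂ) * Complex.I *
        ∫ η in Ioi (0 : ℝ), Complex.exp (-w * (η : ℂ)) * angularFourier χ (ξ - σ * η) := by
  have h_int : Integrable (Function.uncurry fun (x η : ℝ) =>
      Complex.exp (-Complex.I * (x : ℂ) * (ξ : ℂ)) * χ x *
        Complex.exp ((σ * Complex.I * x - w) * (η : ℂ)))
      (volume.prod (volume.restrict (Ioi (0 : ℝ)))) := by
    have h1 := hχ.mul_prod (integrableOn_exp_mul_complex_Ioi (a := -w) (by simpa using hw) 0)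
    refine (h1.bdd_mul (c := 1) (f := fun p : ℝ × ℝ => Complex.exp
      (-Complex.I * (p.1 : ℂ) * (ξ : ℂ) + σ * Complex.I * p.1 * p.2))
      (Continuous.aestronglyMeasurable (by fun_prop))
      (Filter.Eventually.of_forall fun p => ?_)).congr (Filter.Eventually.of_forall fun p => ?_)
    · simp [Complex.norm_exp]
    · simp only [Function.uncurry]
      rw [sub_mul, sub_eq_add_neg, Complex.exp_add, Complex.exp_add, neg_mul w]
      ring
  have h := integral_integral_swap h_int
  simp only [angularFourier]
  rw [show (∫ x : ℝ, Complex.exp (-Complex.I * (x : ℂ) * (ξ : ℂ)) *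
      (χ x * ((x : ℂ) + σ * Complex.I * w)⁻¹)) = -(σ : ℂ) * Complex.I * ∫ x : ℝ,
      ∫ η in Ioi (0 : ℝ), Complex.exp (-Complex.I * (x : ℂ) * (ξ : ℂ)) * χ x *
        Complex.exp ((σ * Complex.I * x - w) * (η : ℂ)) from ?_, h]
  · congr 1
    refine integral_congr_ae (Filter.Eventually.of_forall fun η => ?_)
    simp only
    rw [← integral_const_mul]
    refine integral_congr_ae (Filter.Eventually.of_forall fun x => ?_)
    simp only
    rw [mul_right_comm, ← mul_assoc, ← Complex.exp_add, ← Complex.exp_add]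
    congr 2
    push_cast
    ring
  · rw [← integral_const_mul]
    refine integral_congr_ae (Filter.Eventually.of_forall fun x => ?_)
    simp only
    rw [inv_eq_integral_exp hσ x hw, integral_const_mul]
    ring

lemma integrable_comp_sub_mul {h : ℝ → ℂ} (hi : Integrable h)
    {σ : ℝ} (hσ : σ = 1 ∨ σ = -1) (ξ : ℝ) : Integrable fun η => h (ξ - σ * η) := by
  have := (hi.comp_sub_left ξ).comp_mul_left' (R := σ) (by rcases hσ with rfl | rfl <;> norm_num)
  exact this

lemma integral_norm_comp_sub_mul (h : ℝ → ℂ) {σ : ℝ} (hσ : σ = 1 ∨ σ = -1) (ξ : ℝ) :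
    ∫ η, ‖h (ξ - σ * η)‖ = ∫ η, ‖h η‖ := by
  rcases hσ with rfl | rfl
  · simpa using integral_sub_left_eq_self (fun η => ‖h η‖) volume ξ
  · simpa using integral_add_left_eq_self (μ := volume) (fun η => ‖h η‖) ξ

lemma norm_exp_neg_mul_le_one {w : ℂ} (hw : 0 ≤ w.re) {η : ℝ} (hη : 0 ≤ η) :
    ‖Complex.exp (-w * (η : ℂ))‖ ≤ 1 := by
  rw [Complex.norm_exp, Real.exp_le_one_iff]
  simpa using mul_nonneg hw hη

lemma norm_setIntegral_exp_mul_le {h : ℝ → ℂ} (hi : Integrable h)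
    {σ : ℝ} (hσ : σ = 1 ∨ σ = -1) {w : ℂ} (hw : 0 ≤ w.re) (ξ : ℝ) :
    ‖∫ η in Ioi (0 : ℝ), Complex.exp (-w * (η : ℂ)) * h (ξ - σ * η)‖ ≤ ∫ η, ‖h η‖ := by
  have hn := (integrable_comp_sub_mul hi hσ ξ).norm
  rw [← integral_norm_comp_sub_mul h hσ ξ]
  refine (norm_integral_le_of_norm_le hn.integrableOn ?_).trans
    (setIntegral_le_integral hn (Filter.Eventually.of_forall fun _ => norm_nonneg _))
  filter_upwards [ae_restrict_mem measurableSet_Ioi] with η hη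
  rw [norm_mul]
  exact mul_le_of_le_one_left (norm_nonneg _) (norm_exp_neg_mul_le_one hw (le_of_lt hη))

lemma tendsto_setIntegral_exp_mul {h : ℝ → ℂ} (hi : Integrable h)
    {σ : ℝ} (hσ : σ = 1 ∨ σ = -1) {c : ℂ} (hc : 0 < c.re) (ξ : ℝ) :
    Filter.Tendsto (fun ε : ℝ =>
        ∫ η in Ioi (0 : ℝ), Complex.exp (-(ε * c) * (η : ℂ)) * h (ξ - σ * η))
      (nhdsWithin 0 (Ioi 0)) (nhds (∫ η in Ioi (0 : ℝ), h (ξ - σ * η))) := by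
  have hn := integrable_comp_sub_mul hi hσ ξ
  refine tendsto_integral_filter_of_dominated_convergence (fun η => ‖h (ξ - σ * η)‖)
    (Filter.Eventually.of_forall fun ε => ?_) ?_ hn.norm.integrableOn
    (Filter.Eventually.of_forall fun η => ?_)
  · exact (Continuous.aestronglyMeasurable (by fun_prop)).mul hn.integrableOn.aestronglyMeasurable
  · filter_upwards [self_mem_nhdsWithin] with ε hε
    filter_upwards [ae_restrict_mem measurableSet_Ioi] with η hη
    rw [norm_mul]
    refine mul_le_of_le_one_left (norm_nonneg _) (norm_exp_neg_mul_le_one ?_ (le_of_lt hη))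
    simpa using (mul_pos hε hc).le
  · have hcont : Continuous fun ε : ℝ => Complex.exp (-(ε * c) * (η : ℂ)) * h (ξ - σ * η) := by
      fun_prop
    refine (hcont.tendsto' 0 _ ?_).mono_left nhdsWithin_le_nhds
    simp

lemma stronglyMeasurable_setIntegral_comp {h : ℝ → ℂ} (hh : Continuous h) {σ : ℝ} :
    StronglyMeasurable fun ξ : ℝ => ∫ η in Ioi (0 : ℝ), h (ξ - σ * η) := by
  have : Continuous (Function.uncurry fun ξ η : ℝ => h (ξ - σ * η)) := by
    unfold Function.uncurry; fun_prop
  exact this.stronglyMeasurable.integral_prod_right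

lemma add_le_mul_norm {σ : ℝ} (hσ : σ = 1 ∨ σ = -1) {m M : ℝ} (hm : 0 < m)
    {w : ℂ} (hw : m ≤ w.re) (hw' : ‖w‖ ≤ M) (x : ℝ) {ε : ℝ} (hε : 0 ≤ ε) :
    |x| + ε ≤ (1 + M / m + 1 / m) * ‖(x : ℂ) + σ * Complex.I * ε * w‖ := by
  have hσ1 : |σ| = 1 := by rcases hσ with rfl | rfl <;> norm_num
  set z := (x : ℂ) + σ * Complex.I * ε * w with hz
  have hσε : ‖(σ * Complex.I * ε * w : ℂ)‖ = ε * ‖w‖ := by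
    simp [hσ1, abs_of_nonneg hε]
  have h1 : ε ≤ ‖z‖ / m := by
    rw [le_div_iff₀ hm]
    have : |z.im| = ε * w.re := by
      have : z.im = σ * (ε * w.re) := by simp [hz]; ring
      rw [this, abs_mul, hσ1, one_mul, abs_of_nonneg (mul_nonneg hε (hm.le.trans hw))]
    calc ε * m ≤ ε * w.re := by gcongr
      _ = |z.im| := this.symm
      _ ≤ ‖z‖ := Complex.abs_im_le_norm z
  have hM : 0 ≤ M := (norm_nonneg _).trans hw'
  have h2 : |x| ≤ ‖z‖ + ε * M := by
    have : ‖(x : ℂ)‖ ≤ ‖z‖ + ‖(σ * Complex.I * ε * w : ℂ)‖ := by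
      rw [show (x : ℂ) = z - σ * Complex.I * ε * w by simp [hz]]
      exact norm_sub_le _ _
    rw [hσε, Complex.norm_real, Real.norm_eq_abs] at this
    exact this.trans (by gcongr)
  have h3 : ε * M ≤ ‖z‖ / m * M := by gcongr
  calc |x| + ε ≤ ‖z‖ + ‖z‖ / m * M + ‖z‖ / m := by linarith
    _ = _ := by ring

lemma exists_uniform_bounds {U : Set ℝ} (hU : Convex ℝ U) {ε₀ : ℝ} (hε₀ : 0 < ε₀) {ψ : ℝ → ℝ → ℂ}
    (hψ : ContDiffOn ℝ (⊤ : ℕ∞) (fun p : ℝ × ℝ => ψ p.1 p.2) (U ×ˢ Ico 0 ε₀))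
    (hre : ∀ x ∈ U, ∀ ε ∈ Ico (0 : ℝ) ε₀, 0 < (ψ x ε).re)
    {K : Set ℝ} (hK : IsCompact K) (hKU : K ⊆ U) (h0 : 0 ∈ K) :
    ∃ m > 0, ∃ M L : ℝ, 0 ≤ L ∧ ∀ x ∈ K, ∀ ε ∈ Icc (0 : ℝ) (ε₀ / 2),
      m ≤ (ψ x ε).re ∧ ‖ψ x ε‖ ≤ M ∧ ‖ψ x ε - ψ 0 0‖ ≤ L * (|x| + ε) := by
  have hsub : K ×ˢ Icc 0 (ε₀ / 2) ⊆ U ×ˢ Ico 0 ε₀ :=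
    prod_mono hKU (Icc_subset_Ico_right (by linarith))
  have hmem : ((0 : ℝ), (0 : ℝ)) ∈ K ×ˢ Icc 0 (ε₀ / 2) := ⟨h0, le_rfl, by positivity⟩
  have hc : ContinuousOn (fun p : ℝ × ℝ => ψ p.1 p.2) (K ×ˢ Icc 0 (ε₀ / 2)) :=
    hψ.continuousOn.mono hsub
  have hcomp : IsCompact (K ×ˢ Icc 0 (ε₀ / 2)) := hK.prod isCompact_Icc
  obtain ⟨p, hp, hpmin⟩ := hcomp.exists_isMinOn ⟨_, hmem⟩
    (Complex.continuous_re.comp_continuousOn hc)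
  obtain ⟨M, hM⟩ := hcomp.exists_bound_of_continuousOn hc
  obtain ⟨C, t, ht, hC⟩ := ((hψ _ (hsub hmem)).of_le
    (by exact_mod_cast le_top)).exists_lipschitzOnWith (hU.prod (convex_Ico 0 ε₀))
  obtain ⟨r, hr, hrt⟩ := Metric.mem_nhdsWithin_iff.1 ht
  have hM0 : 0 ≤ M := (norm_nonneg _).trans (hM _ hmem)
  refine ⟨(ψ p.1 p.2).re, hre _ (hsub hp).1 _ (hsub hp).2, M, C + 2 * M / r, by positivity,
    fun x hx ε hε => ⟨hpmin (a := (x, ε)) ⟨hx, hε⟩, hM (x, ε) ⟨hx, hε⟩, ?_⟩⟩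
  have hnn : 0 ≤ |x| + ε := add_nonneg (abs_nonneg x) hε.1
  rcases lt_or_ge (|x| + ε) r with h | h
  · have hdist : dist ((x, ε) : ℝ × ℝ) (0, 0) ≤ |x| + ε := by
      rw [Prod.dist_eq, Real.dist_0_eq_abs, Real.dist_0_eq_abs, abs_of_nonneg hε.1]
      exact max_le (by linarith [hε.1]) (by linarith [abs_nonneg x])
    have h1 := hC.dist_le_mul (x, ε) (hrt ⟨Metric.mem_ball.2 (hdist.trans_lt h), hsub ⟨hx, hε⟩⟩)
      (0, 0) (hrt ⟨Metric.mem_ball_self hr, hsub hmem⟩)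
    rw [dist_eq_norm] at h1
    calc ‖ψ x ε - ψ 0 0‖ ≤ C * (|x| + ε) := h1.trans (by gcongr)
      _ ≤ _ := by gcongr; exact le_add_of_nonneg_right (by positivity)
  · calc ‖ψ x ε - ψ 0 0‖ ≤ M + M := norm_sub_le_of_le (hM (x, ε) ⟨hx, hε⟩) (hM _ hmem)
      _ = 2 * M / r * r := by field_simp; ring
      _ ≤ 2 * M / r * (|x| + ε) := by gcongr
      _ ≤ _ := by gcongr; exact le_add_of_nonneg_left (by positivity)

lemma norm_inv_sub_inv_le {z w : ℂ} {A B D : ℝ} (hB : 0 < B) (hA : 0 ≤ A)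
    (hz : B ≤ A * ‖z‖) (hw : B ≤ A * ‖w‖) (hzw : ‖w - z‖ ≤ D * B ^ 2) :
    ‖z⁻¹ - w⁻¹‖ ≤ D * A ^ 2 := by
  have hz0 : z ≠ 0 := by rintro rfl; simp at hz; linarith
  have hw0 : w ≠ 0 := by rintro rfl; simp at hw; linarith
  have hD : 0 ≤ D := nonneg_of_mul_nonneg_left ((norm_nonneg _).trans hzw) (by positivity)
  rw [inv_sub_inv hz0 hw0, norm_div, norm_mul, div_le_iff₀ (by positivity)]
  calc ‖w - z‖ ≤ D * (B * B) := by rw [← sq]; exact hzw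
    _ ≤ D * ((A * ‖z‖) * (A * ‖w‖)) := by gcongr
    _ = _ := by ring

lemma continuous_mul_of_tsupport_subset {χ f : ℝ → ℂ} (hχ : Continuous χ) {U : Set ℝ}
    (hU : IsOpen U) (hχU : tsupport χ ⊆ U) (hf : ContinuousOn f U) :
    Continuous fun x => χ x * f x := by
  refine continuous_of_tsupport fun x hx => ?_
  have hxU : x ∈ U := hχU (tsupport_mul_subset_left hx)
  exact hχ.continuousAt.mul (hf.continuousAt (hU.mem_nhds hxU))

lemma add_sign_I_mul_ne_zero {σ : ℝ} (hσ : σ = 1 ∨ σ = -1) (x : ℝ) {w : ℂ} (hw : 0 < w.re) :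
    (x : ℂ) + σ * Complex.I * w ≠ 0 := by
  intro h
  have h1 := congrArg Complex.im h
  rcases hσ with rfl | rfl <;> simp at h1 <;> linarith

lemma integrable_mul_inv {U : Set ℝ} (hU : IsOpen U) {χ : ℝ → ℂ} (hχ : Continuous χ)
    (hχc : HasCompactSupport χ) (hχU : tsupport χ ⊆ U) {σ : ℝ} (hσ : σ = 1 ∨ σ = -1)
    {w : ℝ → ℂ} (hw : ContinuousOn w U) (hre : ∀ x ∈ U, 0 < (w x).re) :
    Integrable fun x => χ x * ((x : ℂ) + σ * Complex.I * w x)⁻¹ := by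
  refine (continuous_mul_of_tsupport_subset hχ hU hχU ?_).integrable_of_hasCompactSupport
    hχc.mul_right
  refine ContinuousOn.inv₀ ?_ fun x hx => add_sign_I_mul_ne_zero hσ x (hre x hx)
  exact Complex.continuous_ofReal.continuousOn.add (continuousOn_const.mul hw)

lemma tendsto_integral_norm_mul_inv_sub {U : Set ℝ} (hUc : Convex ℝ U)
    (h0 : (0 : ℝ) ∈ U) {ε₀ : ℝ} (hε₀ : 0 < ε₀) {ψ : ℝ → ℝ → ℂ}
    (hψ : ContDiffOn ℝ (⊤ : ℕ∞) (fun p : ℝ × ℝ => ψ p.1 p.2) (U ×ˢ Ico 0 ε₀))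
    (hre : ∀ x ∈ U, ∀ ε ∈ Ico (0 : ℝ) ε₀, 0 < (ψ x ε).re)
    {σ : ℝ} (hσ : σ = 1 ∨ σ = -1) {χ : ℝ → ℂ} (hχ : Continuous χ)
    (hχc : HasCompactSupport χ) (hχU : tsupport χ ⊆ U)
    (h_int : ∀ᶠ ε : ℝ in nhdsWithin 0 (Ioi 0),
      Integrable fun x => χ x * ((x : ℂ) + σ * Complex.I * (ε * ψ x ε))⁻¹)
    (h_int' : ∀ᶠ ε : ℝ in nhdsWithin 0 (Ioi 0),
      Integrable fun x => χ x * ((x : ℂ) + σ * Complex.I * (ε * ψ 0 0))⁻¹) :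
    Filter.Tendsto (fun ε : ℝ => ∫ x, ‖χ x * ((x : ℂ) + σ * Complex.I * (ε * ψ x ε))⁻¹
        - χ x * ((x : ℂ) + σ * Complex.I * (ε * ψ 0 0))⁻¹‖)
      (nhdsWithin 0 (Ioi 0)) (nhds 0) := by
  have hKU : insert 0 (tsupport χ) ⊆ U := insert_subset h0 hχU
  obtain ⟨m, hm, M, L, hL, hb⟩ := exists_uniform_bounds hUc hε₀ hψ hre
    (hχc.isCompact.insert 0) hKU (mem_insert _ _)
  have hc := hb 0 (mem_insert _ _) 0 ⟨le_rfl, by positivity⟩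
  have hM : 0 ≤ M := (norm_nonneg _).trans hc.2.1
  have hσ1 : |σ| = 1 := by rcases hσ with rfl | rfl <;> norm_num
  have hsmall : ∀ᶠ ε : ℝ in nhdsWithin 0 (Ioi 0), ε ∈ Ioc 0 (ε₀ / 2) :=
    Ioc_mem_nhdsGT (by positivity)
  rw [show nhds (0 : ℝ) = nhds (∫ _ : ℝ, (0 : ℝ)) by rw [integral_zero]]
  refine tendsto_integral_filter_of_dominated_convergence
    (fun x => ‖χ x‖ * (L * (1 + M / m + 1 / m) ^ 2)) ?_ ?_ ?_ ?_
  · filter_upwards [h_int, h_int'] with ε h h'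
    exact (h.sub h').norm.aestronglyMeasurable
  · filter_upwards [hsmall] with ε hε
    refine Filter.Eventually.of_forall fun x => ?_
    rw [norm_norm, ← mul_sub, norm_mul]
    by_cases hx : x ∈ tsupport χ
    · gcongr
      have hx' := hb x (mem_insert_of_mem _ hx) ε ⟨hε.1.le, hε.2⟩
      refine norm_inv_sub_inv_le (B := |x| + ε) (by linarith [abs_nonneg x, hε.1]) (by positivity)
        ?_ ?_ ?_
      · simpa only [mul_assoc] using add_le_mul_norm hσ hm hx'.1 hx'.2.1 x hε.1.le
      · simpa only [mul_assoc] using add_le_mul_norm hσ hm hc.1 hc.2.1 x hε.1.le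
      · have : (x : ℂ) + σ * Complex.I * (ε * ψ 0 0) - (x + σ * Complex.I * (ε * ψ x ε)) =
            -(σ * Complex.I * ε) * (ψ x ε - ψ 0 0) := by ring
        rw [this, norm_mul]
        have h1 : ‖-((σ : ℂ) * Complex.I * ε)‖ = ε := by
          simp [hσ1, abs_of_pos hε.1]
        rw [h1]
        have hnn : 0 ≤ |x| + ε := by linarith [abs_nonneg x, hε.1]
        calc ε * ‖ψ x ε - ψ 0 0‖ ≤ (|x| + ε) * (L * (|x| + ε)) :=
              mul_le_mul (by linarith [abs_nonneg x]) hx'.2.2 (norm_nonneg _) hnn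
          _ = _ := by ring
    · simp [image_eq_zero_of_notMem_tsupport hx]
  · exact (hχ.integrable_of_hasCompactSupport hχc).norm.mul_const _
  · have hne : ∀ᵐ x : ℝ, x ≠ 0 := by simp [ae_iff]
    filter_upwards [hne] with x hx0
    by_cases hx : x ∈ tsupport χ
    · have hψx : Filter.Tendsto (fun ε => ψ x ε) (nhdsWithin 0 (Ioi 0)) (nhds (ψ x 0)) := by
        have h1 : ContinuousOn (fun ε => ψ x ε) (Ico 0 ε₀) :=
          hψ.continuousOn.comp (f := fun ε => (x, ε)) (by fun_prop) fun ε hε => ⟨hχU hx, hε⟩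
        have h2 := h1 0 ⟨le_rfl, hε₀⟩
        exact (h2.mono Ioo_subset_Ico_self).tendsto.mono_left
          (by rw [nhdsWithin_Ioo_eq_nhdsGT hε₀])
      have hε : Filter.Tendsto (fun ε : ℝ => (ε : ℂ)) (nhdsWithin 0 (Ioi 0)) (nhds 0) :=
        (Complex.continuous_ofReal.tendsto' 0 0 (by simp)).mono_left nhdsWithin_le_nhds
      have key : ∀ (u : ℝ → ℂ) (l : ℂ), Filter.Tendsto u (nhdsWithin 0 (Ioi 0)) (nhds l) →
          Filter.Tendsto (fun ε : ℝ => χ x * ((x : ℂ) + σ * Complex.I * (ε * u ε))⁻¹)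
            (nhdsWithin 0 (Ioi 0)) (nhds (χ x * (x : ℂ)⁻¹)) := by
        intro u l hu
        have h1 := ((hε.mul hu).const_mul ((σ : ℂ) * Complex.I)).const_add (x : ℂ)
        rw [zero_mul, mul_zero, add_zero] at h1
        exact (h1.inv₀ (by exact_mod_cast hx0)).const_mul _
      simpa using ((key _ _ hψx).sub (key (fun _ => ψ 0 0) _ tendsto_const_nhds)).norm
    · simp [image_eq_zero_of_notMem_tsupport hx]

/-- Let `J = (a,b) ∋ 0` and `ψ : J × [0,ε₀) → ℂ` smooth with `Re ψ > 0`.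
Then `(x + σiεψ(x,ε))⁻¹ → (x + σi0)⁻¹` as `ε → 0⁺` in `H^s_loc(J)` for every `s < −1/2`:
for every cutoff `χ ∈ C_c^∞(J)`, the weighted `L²` (Fourier-side) distance between the
transform of `χ·(x + σiεψ)⁻¹` and the transform `F₀` of `χ·(x + σi0)⁻¹`
(`F₀(ξ) = −σi ∫₀^∞ χ̂(ξ − ση) dη`) tends to `0`. -/
theorem stmt12 (a b ε₀ : ℝ) (ha : a < 0) (hb : 0 < b) (hε₀ : 0 < ε₀)
    (ψ : ℝ → ℝ → ℂ)
    (hψ : ContDiffOn ℝ (⊤ : ℕ∞) (fun p : ℝ × ℝ => ψ p.1 p.2) (Ioo a b ×ˢ Ico 0 ε₀))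
    (hre : ∀ x ∈ Ioo a b, ∀ ε ∈ Ico (0 : ℝ) ε₀, 0 < (ψ x ε).re)
    (σ : ℝ) (hσ : σ = 1 ∨ σ = -1)
    (s : ℝ) (hs : s < -(1 / 2))
    (χ : ℝ → ℂ) (hχ : ContDiff ℝ (⊤ : ℕ∞) χ) (hχc : HasCompactSupport χ)
    (hχsupp : tsupport χ ⊆ Ioo a b) :
    Filter.Tendsto (fun ε : ℝ =>
        ∫ ξ : ℝ, (1 + ξ ^ 2) ^ s *
          ‖(∫ x : ℝ, Complex.exp (-Complex.I * (x : ℂ) * (ξ : ℂ)) * χ x *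
              ((x : ℂ) + (σ : ℂ) * Complex.I * (ε : ℂ) * ψ x ε)⁻¹)
            - (-(σ : ℂ) * Complex.I *
                ∫ η in Ioi (0 : ℝ),
                  ∫ x : ℝ, Complex.exp (-Complex.I * (x : ℂ) * ((ξ - σ * η : ℝ) : ℂ)) * χ x)‖ ^ 2)
      (nhdsWithin 0 (Ioi 0)) (nhds 0) := by
  have h0 : (0 : ℝ) ∈ Ioo a b := ⟨ha, hb⟩
  have hc : 0 < (ψ 0 0).re := hre 0 h0 0 ⟨le_rfl, hε₀⟩
  have hχi : Integrable χ := hχ.continuous.integrable_of_hasCompactSupport hχc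
  have hFi := integrable_angularFourier hχ hχc
  have hFc := continuous_angularFourier hχi
  have hsmall : ∀ᶠ ε : ℝ in nhdsWithin 0 (Ioi 0), ε ∈ Ioo 0 ε₀ := Ioo_mem_nhdsGT hε₀
  have h_int : ∀ᶠ ε : ℝ in nhdsWithin 0 (Ioi 0),
      Integrable fun x => χ x * ((x : ℂ) + σ * Complex.I * (ε * ψ x ε))⁻¹ := by
    filter_upwards [hsmall] with ε hε
    refine integrable_mul_inv isOpen_Ioo hχ.continuous hχc hχsupp hσ
      (w := fun x => ε * ψ x ε) ?_ fun x hx => ?_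
    · exact continuousOn_const.mul (hψ.continuousOn.comp (f := fun x => (x, ε)) (by fun_prop)
        fun x hx => ⟨hx, hε.1.le, hε.2⟩)
    · simpa using mul_pos hε.1 (hre x hx ε ⟨hε.1.le, hε.2⟩)
  have h_int' : ∀ᶠ ε : ℝ in nhdsWithin 0 (Ioi 0),
      Integrable fun x => χ x * ((x : ℂ) + σ * Complex.I * (ε * ψ 0 0))⁻¹ := by
    filter_upwards [hsmall] with ε hε
    exact integrable_mul_inv isOpen_Ioo hχ.continuous hχc hχsupp hσ
      (w := fun _ => ε * ψ 0 0) continuousOn_const fun x _ => by simpa using mul_pos hε.1 hc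
  have hD := tendsto_integral_norm_mul_inv_sub (convex_Ioo a b) h0 hε₀ hψ hre hσ
    hχ.continuous hχc hχsupp h_int h_int'
  set D : ℝ → ℝ := fun ε => ∫ x, ‖χ x * ((x : ℂ) + σ * Complex.I * (ε * ψ x ε))⁻¹
    - χ x * ((x : ℂ) + σ * Complex.I * (ε * ψ 0 0))⁻¹‖
  set F₀ : ℝ → ℂ := fun ξ => -(σ : ℂ) * Complex.I *
    ∫ η in Ioi (0 : ℝ), angularFourier χ (ξ - σ * η) with hF₀
  set P : ℝ → ℝ → ℂ := fun ε ξ => -(σ : ℂ) * Complex.I *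
    ∫ η in Ioi (0 : ℝ), Complex.exp (-(ε * ψ 0 0) * (η : ℂ)) * angularFourier χ (ξ - σ * η)
    with hP
  set G : ℝ → ℝ → ℂ := fun ε =>
    angularFourier fun x => χ x * ((x : ℂ) + σ * Complex.I * (ε * ψ x ε))⁻¹ with hG
  have hgoal : (fun ε : ℝ => ∫ ξ : ℝ, (1 + ξ ^ 2) ^ s * ‖G ε ξ - F₀ ξ‖ ^ 2) = fun ε : ℝ =>
      ∫ ξ : ℝ, (1 + ξ ^ 2) ^ s *
          ‖(∫ x : ℝ, Complex.exp (-Complex.I * (x : ℂ) * (ξ : ℂ)) * χ x *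
              ((x : ℂ) + (σ : ℂ) * Complex.I * (ε : ℂ) * ψ x ε)⁻¹)
            - (-(σ : ℂ) * Complex.I *
                ∫ η in Ioi (0 : ℝ),
                  ∫ x : ℝ, Complex.exp (-Complex.I * (x : ℂ) * ((ξ - σ * η : ℝ) : ℂ)) *
                    χ x)‖ ^ 2 := by
    simp only [hG, hF₀, angularFourier, mul_assoc]
  rw [← hgoal]
  have hσI : ‖-(σ : ℂ) * Complex.I‖ = 1 := by rcases hσ with rfl | rfl <;> simp
  have hF₀le : ∀ ξ, ‖F₀ ξ‖ ≤ ∫ η, ‖angularFourier χ η‖ := fun ξ => by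
    have := norm_setIntegral_exp_mul_le hFi hσ (w := 0) le_rfl ξ
    simpa only [hF₀, norm_mul _ (∫ _ in _, _), hσI, one_mul, neg_zero, zero_mul,
      Complex.exp_zero] using this
  have hPle : ∀ ε : ℝ, 0 < ε → ∀ ξ, ‖P ε ξ‖ ≤ ∫ η, ‖angularFourier χ η‖ := fun ε hε ξ => by
    have := norm_setIntegral_exp_mul_le hFi hσ (w := ε * ψ 0 0)
      (by simpa using (mul_pos hε hc).le) ξ
    simpa only [hP, norm_mul _ (∫ _ in _, _), hσI, one_mul] using this
  have hPlim : ∀ ξ, Filter.Tendsto (fun ε => P ε ξ) (nhdsWithin 0 (Ioi 0)) (nhds (F₀ ξ)) :=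
    fun ξ => (tendsto_setIntegral_exp_mul hFi hσ hc ξ).const_mul _
  have hGP : ∀ᶠ ε : ℝ in nhdsWithin 0 (Ioi 0), ∀ ξ, ‖G ε ξ - P ε ξ‖ ≤ D ε := by
    filter_upwards [h_int, h_int', self_mem_nhdsWithin] with ε h h' hε ξ
    have hw : 0 < ((ε : ℂ) * ψ 0 0).re := by simpa using mul_pos hε hc
    rw [hP]
    simp only
    rw [← angularFourier_mul_inv hχi hσ hw, hG, angularFourier_sub h h']
    exact norm_angularFourier_le _ _
  have hGF : ∀ᶠ ε : ℝ in nhdsWithin 0 (Ioi 0), ∀ ξ,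
      ‖G ε ξ - F₀ ξ‖ ≤ D ε + ‖P ε ξ - F₀ ξ‖ := by
    filter_upwards [hGP] with ε h ξ
    exact (norm_sub_le_norm_sub_add_norm_sub _ (P ε ξ) _).trans (by gcongr; exact h ξ)
  have hweight : Integrable fun ξ : ℝ => (1 + ξ ^ 2) ^ s := by
    have := integrable_rpow_neg_one_add_norm_sq (E := ℝ) (μ := volume) (r := -2 * s)
      (by simp; linarith)
    simpa [Real.norm_eq_abs, sq_abs] using this
  set C := ∫ η, ‖angularFourier χ η‖
  rw [show nhds (0 : ℝ) = nhds (∫ _ : ℝ, (0 : ℝ)) by rw [integral_zero]]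
  refine tendsto_integral_filter_of_dominated_convergence
    (fun ξ => (1 + ξ ^ 2) ^ s * (1 + (C + C)) ^ 2) ?_ ?_ (hweight.mul_const _)
    (Filter.Eventually.of_forall fun ξ => ?_)
  · filter_upwards [h_int] with ε h
    refine hweight.aestronglyMeasurable.mul (AEStronglyMeasurable.pow ?_ 2)
    exact ((continuous_angularFourier h).aestronglyMeasurable.sub
      ((stronglyMeasurable_setIntegral_comp hFc).const_mul _).aestronglyMeasurable).norm
  · filter_upwards [hGF, hD.eventually_le_const one_pos, self_mem_nhdsWithin] with ε h hD1 hε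
    refine Filter.Eventually.of_forall fun ξ => ?_
    rw [Real.norm_of_nonneg (by positivity)]
    gcongr
    exact (h ξ).trans (add_le_add hD1 (norm_sub_le_of_le (hPle ε hε ξ) (hF₀le ξ)))
  · have hlim : Filter.Tendsto (fun ε => ‖G ε ξ - F₀ ξ‖) (nhdsWithin 0 (Ioi 0)) (nhds 0) := by
      have h1 := hD.add ((hPlim ξ).sub_const (F₀ ξ)).norm
      rw [sub_self, norm_zero, add_zero] at h1
      refine squeeze_zero' (Filter.Eventually.of_forall fun _ => norm_nonneg _) ?_ h1
      filter_upwards [hGF] with ε h using h ξ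
    simpa using (hlim.pow 2).const_mul ((1 + ξ ^ 2) ^ s)
end
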